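/- Assume that 3 divides n and that m/s divides q^2 - q + 1. Then the automorphism group Aut(F/K) of the function field F of the curve Y_{n,s} is finite of order (q^3+1)·q^3·(q^2-1)·(m/s); moreover the subgroup N := {σ ∈ Aut(F/K) : σ(x) = x and σ(y) = y} is cyclic of order m/s, is normal in Aut(F/K), and the quotient group Aut(F/K)/N has order (q^3+1)·q^3·(q^2-1). -/

import Mathlib

open MvPolynomial

/-- The defining ideal of the curve `Y_{n,s}` : it is generated by
`Z^(m/s) - (Y^(q^2) - Y)` and `Y^(q+1) - (X^q + X)` in `K[X,Y,Z]`
(variables `X 0 = X`, `X 1 = Y`, `X 2 = Z`, and `t` stands for `m/s`). -/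
noncomputable def YIdeal (K : Type) [Field K] (q t : ℕ) : Ideal (MvPolynomial (Fin 3) K) :=
  Ideal.span {X 2 ^ t - (X 1 ^ (q ^ 2) - X 1), X 1 ^ (q + 1) - (X 0 ^ q + X 0)}

/-- The coordinate ring `K[X,Y,Z]/I` of the curve `Y_{n,s}`. -/
noncomputable abbrev YRing (K : Type) [Field K] (q t : ℕ) :=
  MvPolynomial (Fin 3) K ⧸ YIdeal K q t

/-- The function field `F = Frac(K[X,Y,Z]/I)` of the curve `Y_{n,s}`. -/
noncomputable abbrev YField (K : Type) [Field K] (q t : ℕ) :=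
  FractionRing (YRing K q t)

/-- The coordinate function `x ∈ F`, image of the variable `X`. -/
noncomputable def Yx (K : Type) [Field K] (q t : ℕ) : YField K q t :=
  algebraMap (YRing K q t) (YField K q t) (Ideal.Quotient.mk _ (X 0))

/-- The coordinate function `y ∈ F`, image of the variable `Y`. -/
noncomputable def Yy (K : Type) [Field K] (q t : ℕ) : YField K q t :=
  algebraMap (YRing K q t) (YField K q t) (Ideal.Quotient.mk _ (X 1))


namespace YC1

/-- `v` has value at least `n` at `f` (the value at zero being infinite). -/
def G {F : Type} [Field F] (v : F → ℤ) (n : ℤ) (f : F) : Prop := f = 0 ∨ n ≤ v f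

/-- `f` is nonzero of value exactly `n`. -/
def E {F : Type} [Field F] (v : F → ℤ) (n : ℤ) (f : F) : Prop := f ≠ 0 ∧ v f = n

/-- A `K`-rational discrete place of `F`, given by its integer valued order function. -/
structure OV (K : Type) {F : Type} [Field K] [Field F] [Algebra K F] (v : F → ℤ) : Prop where
  mul : ∀ f g, f ≠ 0 → g ≠ 0 → v (f * g) = v f + v g
  add : ∀ f g, f ≠ 0 → g ≠ 0 → f + g ≠ 0 → min (v f) (v g) ≤ v (f + g)
  const : ∀ c : K, c ≠ 0 → v (algebraMap K F c) = 0
  res : ∀ f, G v 0 f → ∃ c : K, G v 1 (f - algebraMap K F c)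

section
variable {K F : Type} [Field K] [Field F] [Algebra K F] {v : F → ℤ}

theorem E.toG {n : ℤ} {f : F} (h : E v n f) : G v n f := Or.inr h.2.ge

theorem G.mono {n m : ℤ} {f : F} (h : G v n f) (hm : m ≤ n) : G v m f :=
  h.imp id (fun h => hm.trans h)

theorem G_zero (n : ℤ) : G v n (0 : F) := Or.inl rfl

theorem G.le {n : ℤ} {f : F} (h : G v n f) (hf : f ≠ 0) : n ≤ v f := h.resolve_left hf

theorem OV.v_one (h : OV K v) : v 1 = 0 := by
  have := h.const 1 one_ne_zero
  simpa using this

theorem OV.v_neg_one (h : OV K v) : v (-1) = 0 := by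
  have := h.const (-1) (by simp)
  simpa using this

theorem OV.v_neg (h : OV K v) (f : F) : v (-f) = v f := by
  by_cases hf : f = 0
  · simp [hf]
  have := h.mul (-1) f (by simp) hf
  rw [h.v_neg_one] at this
  simpa using this

theorem OV.v_inv (h : OV K v) {f : F} (hf : f ≠ 0) : v f⁻¹ = - v f := by
  have := h.mul f f⁻¹ hf (inv_ne_zero hf)
  rw [mul_inv_cancel₀ hf, h.v_one] at this
  omega

theorem OV.G_neg (h : OV K v) {n : ℤ} {f : F} (hf : G v n f) : G v n (-f) := by
  rcases hf with hf | hf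
  · left; simp [hf]
  · right; rwa [h.v_neg]

theorem OV.G_add (h : OV K v) {n : ℤ} {f g : F} (hf : G v n f) (hg : G v n g) : G v n (f + g) := by
  by_cases hf0 : f = 0
  · simpa [hf0] using hg
  by_cases hg0 : g = 0
  · simpa [hg0] using hf
  by_cases h0 : f + g = 0
  · exact Or.inl h0
  · have := h.add f g hf0 hg0 h0
    have h1 := hf.le hf0
    have h2 := hg.le hg0
    right
    omega

theorem OV.G_sub (h : OV K v) {n : ℤ} {f g : F} (hf : G v n f) (hg : G v n g) : G v n (f - g) := by
  rw [sub_eq_add_neg]; exact h.G_add hf (h.G_neg hg)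

theorem OV.G_mul (h : OV K v) {n m : ℤ} {f g : F} (hf : G v n f) (hg : G v m g) :
    G v (n + m) (f * g) := by
  by_cases hf0 : f = 0
  · left; simp [hf0]
  by_cases hg0 : g = 0
  · left; simp [hg0]
  right
  rw [h.mul f g hf0 hg0]
  have h1 := hf.le hf0
  have h2 := hg.le hg0
  omega

theorem OV.E_mul (h : OV K v) {n m : ℤ} {f g : F} (hf : E v n f) (hg : E v m g) :
    E v (n + m) (f * g) :=
  ⟨mul_ne_zero hf.1 hg.1, by rw [h.mul f g hf.1 hg.1, hf.2, hg.2]⟩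

theorem OV.E_one (h : OV K v) : E v 0 (1 : F) := ⟨one_ne_zero, h.v_one⟩

theorem OV.E_pow (h : OV K v) {n : ℤ} {f : F} (hf : E v n f) (k : ℕ) : E v (k * n) (f ^ k) := by
  induction k with
  | zero => simpa using h.E_one
  | succ k ih =>
    rw [pow_succ]
    have := h.E_mul ih hf
    convert this using 1
    push_cast; ring

theorem OV.G_pow (h : OV K v) {n : ℤ} {f : F} (hf : G v n f) (k : ℕ) : G v (k * n) (f ^ k) := by
  induction k with
  | zero => simpa using h.E_one.toG
  | succ k ih =>
    rw [pow_succ]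
    have := h.G_mul ih hf
    convert this using 1
    push_cast; ring

theorem OV.E_inv (h : OV K v) {n : ℤ} {f : F} (hf : E v n f) : E v (-n) f⁻¹ :=
  ⟨inv_ne_zero hf.1, by rw [h.v_inv hf.1, hf.2]⟩

theorem OV.E_div (h : OV K v) {n m : ℤ} {f g : F} (hf : E v n f) (hg : E v m g) :
    E v (n - m) (f / g) := by
  rw [div_eq_mul_inv, sub_eq_add_neg]; exact h.E_mul hf (h.E_inv hg)

theorem OV.E_zpow (h : OV K v) {n : ℤ} {f : F} (hf : E v n f) (k : ℤ) : E v (k * n) (f ^ k) := by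
  obtain ⟨m, rfl | rfl⟩ := k.eq_nat_or_neg
  · rw [zpow_natCast]; exact h.E_pow hf m
  · rw [zpow_neg, zpow_natCast]
    convert h.E_inv (h.E_pow hf m) using 1
    ring

theorem OV.E_neg (h : OV K v) {n : ℤ} {f : F} (hf : E v n f) : E v n (-f) :=
  ⟨neg_ne_zero.2 hf.1, by rw [h.v_neg, hf.2]⟩

theorem OV.E_const (h : OV K v) {c : K} (hc : c ≠ 0) : E v 0 (algebraMap K F c) :=
  ⟨by simpa using hc, h.const c hc⟩

theorem OV.G_const (h : OV K v) (c : K) : G v 0 (algebraMap K F c) := by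
  by_cases hc : c = 0
  · left; simp [hc]
  · exact (h.E_const hc).toG

/-- dominance: adding something of higher order does not change the order -/
theorem OV.E_add (h : OV K v) {n : ℤ} {f g : F} (hf : E v n f) (hg : G v (n + 1) g) :
    E v n (f + g) := by
  by_cases hg0 : g = 0
  · simpa [hg0] using hf
  have h1 := hg.le hg0
  have h0 : f + g ≠ 0 := by
    intro h0
    have : f = -g := eq_neg_of_add_eq_zero_left h0
    have h2 := hf.2
    rw [this, h.v_neg] at h2
    omega
  refine ⟨h0, ?_⟩
  have h2 := h.add f g hf.1 hg0 h0
  have h3 := h.add (f + g) (-g) h0 (by simpa using hg0) (by simpa using hf.1)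
  rw [add_neg_cancel_right, h.v_neg, hf.2] at h3
  rw [hf.2] at h2
  omega

theorem OV.E_sub (h : OV K v) {n : ℤ} {f g : F} (hf : E v n f) (hg : G v (n + 1) g) :
    E v n (f - g) := by
  rw [sub_eq_add_neg]; exact h.E_add hf (h.G_neg hg)

theorem OV.const_of_G_one (h : OV K v) {c : K} (hc : G v 1 (algebraMap K F c)) : c = 0 := by
  by_contra h0
  have := hc.le (h.E_const h0).1
  rw [(h.E_const h0).2] at this
  omega

theorem E.unique {n m : ℤ} {f : F} (hf : E v n f) (hg : E v m f) : n = m := hf.2.symm.trans hg.2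

theorem E.not_G {n m : ℤ} {f : F} (hf : E v n f) (hg : G v m f) : m ≤ n := by
  have := hg.le hf.1
  rwa [hf.2] at this

theorem OV.comp (h : OV K v) (σ : F ≃ₐ[K] F) : OV K (fun f => v (σ f)) where
  mul f g hf hg := by simp only [_root_.map_mul]; exact h.mul _ _ (by simpa using hf) (by simpa using hg)
  add f g hf hg hfg := by
    simp only [_root_.map_add]
    exact h.add _ _ (by simpa using hf) (by simpa using hg) (by rw [← _root_.map_add]; exact (map_ne_zero σ).2 hfg)
  const c hc := by simpa using h.const c hc
  res f hf := by
    obtain ⟨c, hc⟩ := h.res (σ f) (hf.imp (by simp) id)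
    refine ⟨c, hc.imp (fun h => ?_) (fun h => ?_)⟩
    · apply σ.injective; simpa using h
    · simpa using h

theorem E_comp (σ : F ≃ₐ[K] F) {n : ℤ} {f : F} : E (fun f => v (σ f)) n f ↔ E v n (σ f) := by
  simp [E]

theorem G_comp (σ : F ≃ₐ[K] F) {n : ℤ} {f : F} : G (fun f => v (σ f)) n f ↔ G v n (σ f) := by
  simp [G]

end
end YC1


namespace YC1

/-- The abstract setting: `F` is the function field of the curve. -/
structure Crv (K : Type) {F : Type} [Field K] [Field F] [Algebra K F]
    (p a q t e : ℕ) (x y z : F) : Prop where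
  hp : p.Prime
  ha : 0 < a
  hq : q = p ^ a
  chK : CharP K p
  ht : 1 < t
  hte : t * e + q = q ^ 2 + 1
  r1 : z ^ t = y ^ (q ^ 2) - y
  r2 : y ^ (q + 1) = x ^ q + x
  frac : ∀ f : F, ∃ r ∈ Algebra.adjoin K {x, y, z}, ∃ s ∈ Algebra.adjoin K {x, y, z},
    s ≠ 0 ∧ f = r / s
  lift : ∀ x' y' z' : F, z' ^ t = y' ^ (q ^ 2) - y' → y' ^ (q + 1) = x' ^ q + x' →
    ∃ φ : Algebra.adjoin K {x, y, z} →ₐ[K] F,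
      φ ⟨x, Algebra.subset_adjoin (by simp)⟩ = x' ∧
      φ ⟨y, Algebra.subset_adjoin (by simp)⟩ = y' ∧
      φ ⟨z, Algebra.subset_adjoin (by simp)⟩ = z'

/-- weighted degree of a monomial -/
def dg (q t i j k : ℕ) : ℕ := i * ((q + 1) * t) + j * (q * t) + k * q ^ 3

section
variable {K F : Type} [Field K] [Field F] [Algebra K F] {p a q t e : ℕ} {x y z : F}

/-- span of the reduced monomials of degree less than `D` -/
def NM (K : Type) {F : Type} [Field K] [Field F] [Algebra K F] (q t : ℕ) (x y z : F) (D : ℕ) :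
    Submodule K F :=
  Submodule.span K {f | ∃ i j k, j ≤ q ∧ k < t ∧ dg q t i j k < D ∧ f = x ^ i * y ^ j * z ^ k}

/-- leading term -/
def Lead (K : Type) {F : Type} [Field K] [Field F] [Algebra K F] (q t : ℕ) (x y z : F)
    (f : F) (n : ℕ) : Prop :=
  ∃ i j k, j ≤ q ∧ k < t ∧ dg q t i j k = n ∧ ∃ c : K, c ≠ 0 ∧
    f - c • (x ^ i * y ^ j * z ^ k) ∈ NM K q t x y z n

theorem Crv.q2 (C : Crv K p a q t e x y z) : 2 ≤ q := by
  rw [C.hq]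
  calc 2 ≤ p := C.hp.two_le
    _ ≤ p ^ a := Nat.le_self_pow C.ha.ne' p

theorem Crv.cop (C : Crv K p a q t e x y z) : Nat.Coprime t q := by
  have h := C.hte
  have h1 : Nat.gcd t q ∣ q ^ 2 + 1 := by
    rw [← h]
    exact Dvd.dvd.add ((Nat.gcd_dvd_left t q).mul_right e) (Nat.gcd_dvd_right t q)
  have h2 : Nat.gcd t q ∣ q ^ 2 := (Nat.gcd_dvd_right t q).trans (dvd_pow_self q two_ne_zero)
  exact Nat.dvd_one.1 ((Nat.dvd_add_right h2).1 h1)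

theorem Crv.e1 (C : Crv K p a q t e x y z) : 1 ≤ e := by
  rcases Nat.eq_zero_or_pos e with h | h
  · have := C.hte
    have := C.q2
    subst h
    nlinarith
  · exact h

theorem Crv.tle (C : Crv K p a q t e x y z) : t + q ≤ q ^ 2 + 1 := by
  have := C.hte
  have := C.e1
  nlinarith

theorem Crv.tlt (C : Crv K p a q t e x y z) : t < q ^ 2 := by
  have := C.tle
  have := C.q2
  omega

theorem Crv.ptF (C : Crv K p a q t e x y z) : CharP F p := by
  have := C.chK
  exact charP_of_injective_algebraMap (algebraMap K F).injective p

theorem Crv.frobF (C : Crv K p a q t e x y z) (n : ℕ) (f g : F) :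
    (f + g) ^ (q ^ n) = f ^ (q ^ n) + g ^ (q ^ n) := by
  have := C.ptF
  have : Fact p.Prime := ⟨C.hp⟩
  rw [C.hq, ← pow_mul]
  exact add_pow_char_pow f g p _

theorem Crv.frobF_sub (C : Crv K p a q t e x y z) (n : ℕ) (f g : F) :
    (f - g) ^ (q ^ n) = f ^ (q ^ n) - g ^ (q ^ n) := by
  have := C.ptF
  have : Fact p.Prime := ⟨C.hp⟩
  rw [C.hq, ← pow_mul]
  exact sub_pow_char_pow f g _

theorem Crv.frobK (C : Crv K p a q t e x y z) (n : ℕ) (f g : K) :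
    (f + g) ^ (q ^ n) = f ^ (q ^ n) + g ^ (q ^ n) := by
  have := C.chK
  have : Fact p.Prime := ⟨C.hp⟩
  rw [C.hq, ← pow_mul]
  exact add_pow_char_pow f g p _

theorem Crv.frobK_sub (C : Crv K p a q t e x y z) (n : ℕ) (f g : K) :
    (f - g) ^ (q ^ n) = f ^ (q ^ n) - g ^ (q ^ n) := by
  have := C.chK
  have : Fact p.Prime := ⟨C.hp⟩
  rw [C.hq, ← pow_mul]
  exact sub_pow_char_pow f g _

theorem Crv.tK (C : Crv K p a q t e x y z) : (t : K) ≠ 0 := by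
  have := C.chK
  intro h
  have h1 := (CharP.cast_eq_zero_iff K p t).1 h
  have h2 : p ∣ q := by rw [C.hq]; exact dvd_pow_self p C.ha.ne'
  exact C.hp.one_lt.ne' (Nat.dvd_one.1 (C.cop ▸ Nat.dvd_gcd h1 h2))

theorem dg_inj (hq : 1 ≤ q) (ht : 1 ≤ t) (hc : Nat.Coprime t q) {i j k i' j' k' : ℕ} (hj : j ≤ q) (hk : k < t)
    (hj' : j' ≤ q) (hk' : k' < t) (h : dg q t i j k = dg q t i' j' k') :
    i = i' ∧ j = j' ∧ k = k' := by
  unfold dg at h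
  have hk2 : k * q ^ 3 ≡ k' * q ^ 3 [MOD t] := by
    have h1 : (i * ((q + 1) * t) + j * (q * t) + k * q ^ 3) ≡ k * q ^ 3 [MOD t] := by
      have : i * ((q + 1) * t) + j * (q * t) + k * q ^ 3 = k * q ^ 3 + t * (i * (q + 1) + j * q) := by ring
      rw [this]
      simp [Nat.ModEq]
    have h2 : (i' * ((q + 1) * t) + j' * (q * t) + k' * q ^ 3) ≡ k' * q ^ 3 [MOD t] := by
      have : i' * ((q + 1) * t) + j' * (q * t) + k' * q ^ 3 = k' * q ^ 3 + t * (i' * (q + 1) + j' * q) := by ring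
      rw [this]
      simp [Nat.ModEq]
    rw [h] at h1
    exact h1.symm.trans h2
  have hkk : k = k' := by
    have := Nat.ModEq.cancel_right_of_coprime (Nat.Coprime.pow_right 3 hc) hk2
    exact Nat.ModEq.eq_of_lt_of_lt this hk hk'
  subst hkk
  have h3 : (i * (q + 1) + j * q) = (i' * (q + 1) + j' * q) := by
    have : t * (i * (q + 1) + j * q) = t * (i' * (q + 1) + j' * q) := by nlinarith
    exact Nat.eq_of_mul_eq_mul_left ht this
  have hij : i + j = i' + j' ∨ i + j < i' + j' ∨ i' + j' < i + j := by omega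
  have h4 : q * (i + j) + i = q * (i' + j') + i' := by nlinarith
  have h5 : (q + 1) * (i + j) = (q + 1) * (i' + j') + j - j' := by
    have : (q + 1) * (i + j) + j' = (q + 1) * (i' + j') + j := by nlinarith
    omega
  have h6 : (q + 1) * (i + j) + j' = (q + 1) * (i' + j') + j := by nlinarith
  have h7 : i + j = i' + j' := by
    rcases hij with h7 | h7 | h7
    · exact h7
    · exfalso
      have : (q + 1) * (i + j + 1) ≤ (q + 1) * (i' + j') := Nat.mul_le_mul_left _ h7
      nlinarith
    · exfalso
      have : (q + 1) * (i' + j' + 1) ≤ (q + 1) * (i + j) := Nat.mul_le_mul_left _ h7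
      nlinarith
  rw [h7] at h6
  omega

/-- span of all reduced monomials -/
def NMall (K : Type) {F : Type} [Field K] [Field F] [Algebra K F] (q t : ℕ) (x y z : F) :
    Submodule K F :=
  Submodule.span K {f | ∃ i j k, j ≤ q ∧ k < t ∧ f = x ^ i * y ^ j * z ^ k}

theorem Crv.span_x (C : Crv K p a q t e x y z) {f : F} (hf : f ∈ NMall K q t x y z) :
    x * f ∈ NMall K q t x y z := by
  refine Submodule.span_induction ?_ ?_ ?_ ?_ hf
  · rintro _ ⟨i, j, k, hj, hk, rfl⟩
    exact Submodule.subset_span ⟨i + 1, j, k, hj, hk, by ring⟩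
  · simp
  · intro f g _ _ hf hg; rw [mul_add]; exact Submodule.add_mem _ hf hg
  · intro c f _ hf; rw [mul_smul_comm]; exact Submodule.smul_mem _ _ hf

theorem Crv.span_y (C : Crv K p a q t e x y z) {f : F} (hf : f ∈ NMall K q t x y z) :
    y * f ∈ NMall K q t x y z := by
  refine Submodule.span_induction ?_ ?_ ?_ ?_ hf
  · rintro _ ⟨i, j, k, hj, hk, rfl⟩
    rcases hj.lt_or_eq with hj | hj
    · exact Submodule.subset_span ⟨i, j + 1, k, hj, hk, by ring⟩
    · have : y * (x ^ i * y ^ j * z ^ k) = x ^ (i + q) * y ^ 0 * z ^ k + x ^ (i + 1) * y ^ 0 * z ^ k := by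
        have h := C.r2
        subst hj
        calc y * (x ^ i * y ^ j * z ^ k) = x ^ i * y ^ (j + 1) * z ^ k := by ring
          _ = _ := by rw [h]; ring
      rw [this]
      exact Submodule.add_mem _ (Submodule.subset_span ⟨_, _, _, by omega, hk, rfl⟩)
        (Submodule.subset_span ⟨_, _, _, by omega, hk, rfl⟩)
  · simp
  · intro f g _ _ hf hg; rw [mul_add]; exact Submodule.add_mem _ hf hg
  · intro c f _ hf; rw [mul_smul_comm]; exact Submodule.smul_mem _ _ hf

theorem Crv.span_yn (C : Crv K p a q t e x y z) {f : F} (hf : f ∈ NMall K q t x y z) (n : ℕ) :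
    y ^ n * f ∈ NMall K q t x y z := by
  induction n with
  | zero => simpa using hf
  | succ n ih => rw [pow_succ', mul_assoc]; exact C.span_y ih

theorem Crv.span_z (C : Crv K p a q t e x y z) {f : F} (hf : f ∈ NMall K q t x y z) :
    z * f ∈ NMall K q t x y z := by
  refine Submodule.span_induction ?_ ?_ ?_ ?_ hf
  · rintro _ ⟨i, j, k, hj, hk, rfl⟩
    rcases Nat.lt_or_ge (k + 1) t with hk' | hk'
    · exact Submodule.subset_span ⟨i, j, k + 1, hj, hk', by ring⟩
    · have : z * (x ^ i * y ^ j * z ^ k) = y ^ (q ^ 2) * (x ^ i * y ^ j * z ^ 0) -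
          y * (x ^ i * y ^ j * z ^ 0) := by
        have h := C.r1
        have hk2 : t = k + 1 := by omega
        subst hk2
        calc z * (x ^ i * y ^ j * z ^ k) = x ^ i * y ^ j * z ^ (k + 1) := by ring
          _ = _ := by rw [h]; ring
      rw [this]
      have h0 : x ^ i * y ^ j * z ^ 0 ∈ NMall K q t x y z :=
        Submodule.subset_span ⟨i, j, 0, hj, by omega, rfl⟩
      exact Submodule.sub_mem _ (C.span_yn h0 _) (C.span_y h0)
  · simp
  · intro f g _ _ hf hg; rw [mul_add]; exact Submodule.add_mem _ hf hg
  · intro c f _ hf; rw [mul_smul_comm]; exact Submodule.smul_mem _ _ hf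

theorem Crv.mem_all (C : Crv K p a q t e x y z) {f : F} (hf : f ∈ Algebra.adjoin K {x, y, z}) :
    f ∈ NMall K q t x y z := by
  suffices h : ∀ g ∈ NMall K q t x y z, f * g ∈ NMall K q t x y z by
    have := h 1 (Submodule.subset_span ⟨0, 0, 0, by omega, by have := C.ht; omega, by simp⟩)
    simpa using this
  refine Algebra.adjoin_induction (p := fun f _ => ∀ g ∈ NMall K q t x y z, f * g ∈ NMall K q t x y z)
    ?_ ?_ ?_ ?_ hf
  · rintro f (rfl | rfl | rfl) g hg
    · exact C.span_x hg
    · exact C.span_y hg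
    · exact C.span_z hg
  · intro c g hg
    rw [← Algebra.smul_def]; exact Submodule.smul_mem _ _ hg
  · intro f f' _ _ h h' g hg
    rw [add_mul]; exact Submodule.add_mem _ (h g hg) (h' g hg)
  · intro f f' _ _ h h' g hg
    rw [mul_assoc]; exact h _ (h' g hg)

theorem NM_mono {D D' : ℕ} (h : D ≤ D') : NM K q t x y z D ≤ NM K q t x y z D' :=
  Submodule.span_mono (fun _ ⟨i, j, k, hj, hk, hd, hf⟩ => ⟨i, j, k, hj, hk, hd.trans_le h, hf⟩)

theorem Crv.mem_NM (C : Crv K p a q t e x y z) {f : F} (hf : f ∈ Algebra.adjoin K {x, y, z}) :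
    ∃ D, f ∈ NM K q t x y z D := by
  refine Submodule.span_induction ?_ ?_ ?_ ?_ (C.mem_all hf)
  · rintro _ ⟨i, j, k, hj, hk, rfl⟩
    exact ⟨dg q t i j k + 1, Submodule.subset_span ⟨i, j, k, hj, hk, by omega, rfl⟩⟩
  · exact ⟨0, Submodule.zero_mem _⟩
  · rintro f g _ _ ⟨D, hf⟩ ⟨D', hg⟩
    exact ⟨max D D', Submodule.add_mem _ (NM_mono (le_max_left _ _) hf) (NM_mono (le_max_right _ _) hg)⟩
  · rintro c f _ ⟨D, hf⟩
    exact ⟨D, Submodule.smul_mem _ _ hf⟩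

theorem Crv.NM_succ (C : Crv K p a q t e x y z) {D : ℕ} {f : F} (hf : f ∈ NM K q t x y z (D + 1)) :
    f ∈ NM K q t x y z D ∨ Lead K q t x y z f D := by
  have hq := C.q2
  have ht := C.ht
  by_cases hex : ∃ i j k, j ≤ q ∧ k < t ∧ dg q t i j k = D
  · obtain ⟨i, j, k, hj, hk, hd⟩ := hex
    have : ∃ c : K, f - c • (x ^ i * y ^ j * z ^ k) ∈ NM K q t x y z D := by
      refine Submodule.span_induction ?_ ?_ ?_ ?_ hf
      · rintro _ ⟨i', j', k', hj', hk', hd', rfl⟩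
        rcases Nat.lt_or_ge (dg q t i' j' k') D with h | h
        · have hmem : x ^ i' * y ^ j' * z ^ k' ∈ NM K q t x y z D :=
            Submodule.subset_span ⟨i', j', k', hj', hk', h, rfl⟩
          exact ⟨0, by simpa using hmem⟩
        · have : dg q t i' j' k' = dg q t i j k := by omega
          obtain ⟨rfl, rfl, rfl⟩ := dg_inj (by omega) (by omega) C.cop hj' hk' hj hk this
          exact ⟨1, by simp⟩
      · exact ⟨0, by simp⟩
      · rintro f g _ _ ⟨c, hf⟩ ⟨c', hg⟩
        refine ⟨c + c', ?_⟩
        have := Submodule.add_mem _ hf hg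
        convert this using 1
        rw [add_smul]; ring
      · rintro b f _ ⟨c, hf⟩
        refine ⟨b * c, ?_⟩
        have := Submodule.smul_mem _ b hf
        convert this using 1
        rw [smul_sub, mul_smul]
    obtain ⟨c, hc⟩ := this
    by_cases h0 : c = 0
    · left; simpa [h0] using hc
    · right; exact ⟨i, j, k, hj, hk, hd, c, h0, hc⟩
  · left
    refine Submodule.span_mono ?_ hf
    rintro _ ⟨i', j', k', hj', hk', hd', rfl⟩
    refine ⟨i', j', k', hj', hk', ?_, rfl⟩
    by_contra h
    exact hex ⟨i', j', k', hj', hk', by omega⟩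

theorem Crv.lead_of_NM (C : Crv K p a q t e x y z) (D : ℕ) {f : F} (hf : f ∈ NM K q t x y z D)
    (h0 : f ≠ 0) : ∃ n < D, Lead K q t x y z f n := by
  induction D with
  | zero =>
    exfalso
    apply h0
    have : NM K q t x y z 0 = ⊥ := by
      unfold NM
      rw [Submodule.span_eq_bot]
      rintro _ ⟨i', j', k', hj', hk', hd', rfl⟩
      omega
    rwa [this, Submodule.mem_bot] at hf
  | succ D ih =>
    rcases C.NM_succ hf with h | h
    · obtain ⟨n, hn, h⟩ := ih h
      exact ⟨n, by omega, h⟩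
    · exact ⟨D, by omega, h⟩

theorem Crv.lead (C : Crv K p a q t e x y z) {f : F} (hf : f ∈ Algebra.adjoin K {x, y, z})
    (h0 : f ≠ 0) : ∃ n, Lead K q t x y z f n := by
  obtain ⟨D, hD⟩ := C.mem_NM hf
  obtain ⟨n, _, h⟩ := C.lead_of_NM D hD h0
  exact ⟨n, h⟩

theorem Lead.mem {f : F} {n : ℕ} (h : Lead K q t x y z f n) : f ∈ NM K q t x y z (n + 1) := by
  obtain ⟨i, j, k, hj, hk, hd, c, hc, hm⟩ := h
  have h1 : c • (x ^ i * y ^ j * z ^ k) ∈ NM K q t x y z (n + 1) :=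
    Submodule.smul_mem _ _ (Submodule.subset_span ⟨i, j, k, hj, hk, by omega, rfl⟩)
  have := Submodule.add_mem _ (NM_mono (Nat.le_succ n) hm) h1
  simpa using this

end
end YC1


namespace YC1

section
variable {K F : Type} [Field K] [Field F] [Algebra K F] {p a q t e : ℕ} {x y z : F}

theorem V_const (V : ValuationSubring F) (hK : ∀ c : K, algebraMap K F c ∈ V) {c : K} (hc : c ≠ 0) :
    V.valuation (algebraMap K F c) = 1 := by
  apply le_antisymm ((V.valuation_le_one_iff _).2 (hK c))
  have h := (V.valuation_le_one_iff _).2 (hK c⁻¹)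
  rw [map_inv₀, map_inv₀] at h
  have h0 : V.valuation (algebraMap K F c) ≠ 0 := by simpa using hc
  exact (inv_le_one₀ (zero_lt_iff.2 h0)).1 h

theorem mem_of_pow_mem (V : ValuationSubring F) {f : F} {n : ℕ} (hn : n ≠ 0) (h : f ^ n ∈ V) :
    f ∈ V := by
  rw [← V.valuation_le_one_iff] at h ⊢
  rw [map_pow] at h
  exact (pow_le_one_iff hn).1 h

theorem adjoin_le_V (V : ValuationSubring F) (hK : ∀ c : K, algebraMap K F c ∈ V)
    (hx : x ∈ V) (hy : y ∈ V) (hz : z ∈ V) {f : F} (hf : f ∈ Algebra.adjoin K {x, y, z}) : f ∈ V := by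
  refine Algebra.adjoin_induction (p := fun f _ => f ∈ V) ?_ ?_ ?_ ?_ hf
  · rintro f (rfl | rfl | rfl) <;> assumption
  · exact hK
  · intro f g _ _ hf hg; exact V.add_mem _ _ hf hg
  · intro f g _ _ hf hg; exact V.mul_mem _ _ hf hg

theorem Crv.V_of_x (C : Crv K p a q t e x y z) (V : ValuationSubring F)
    (hK : ∀ c : K, algebraMap K F c ∈ V) (hx : x ∈ V) :
    ∀ f ∈ Algebra.adjoin K {x, y, z}, f ∈ V := by
  have hy : y ∈ V := by
    apply mem_of_pow_mem V (n := q + 1) (by omega)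
    rw [C.r2]
    exact V.add_mem _ _ (pow_mem hx _) hx
  have hz : z ∈ V := by
    apply mem_of_pow_mem V (n := t) (by have := C.ht; omega)
    rw [C.r1]
    exact sub_mem (pow_mem hy _) hy
  exact fun f hf => adjoin_le_V V hK hx hy hz hf

theorem Crv.w_x (C : Crv K p a q t e x y z) (V : ValuationSubring F) (hx : x ∉ V) :
    V.valuation y ^ (q + 1) = V.valuation x ^ q ∧ 1 < V.valuation y ∧
    V.valuation z ^ t = V.valuation y ^ (q ^ 2) := by
  have hq := C.q2
  have h1 : 1 < V.valuation x := by rw [← V.valuation_le_one_iff] at hx; exact not_le.1 hx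
  have h2 : V.valuation y ^ (q + 1) = V.valuation x ^ q := by
    rw [← map_pow, C.r2]
    rw [Valuation.map_add_eq_of_lt_left, map_pow]
    rw [map_pow]
    calc V.valuation x = V.valuation x ^ 1 := (pow_one _).symm
      _ < _ := pow_lt_pow_right₀ h1 (by omega)
  have h3 : 1 < V.valuation y := by
    by_contra h
    have := pow_le_one₀ zero_le (not_lt.1 h) (n := q + 1)
    rw [h2] at this
    exact absurd (one_lt_pow₀ h1 (by omega : q ≠ 0)) (not_lt.2 this)
  refine ⟨h2, h3, ?_⟩
  rw [← map_pow, C.r1, Valuation.map_sub_eq_of_lt_left, map_pow]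
  rw [map_pow]
  calc V.valuation y = V.valuation y ^ 1 := (pow_one _).symm
      _ < _ := pow_lt_pow_right₀ h3 (by nlinarith)

theorem Crv.w_mon (C : Crv K p a q t e x y z) (V : ValuationSubring F) (hx : x ∉ V) (i j k : ℕ) :
    V.valuation (x ^ i * y ^ j * z ^ k) ^ (q * t) = V.valuation y ^ (dg q t i j k) := by
  obtain ⟨h1, h2, h3⟩ := C.w_x V hx
  simp only [map_mul, map_pow]
  simp only [mul_pow, ← pow_mul]
  have e1 : V.valuation x ^ (i * (q * t)) = V.valuation y ^ (i * ((q + 1) * t)) := by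
    rw [show i * (q * t) = q * (i * t) by ring, pow_mul, ← h1, ← pow_mul]
    congr 1; ring
  have e3 : V.valuation z ^ (k * (q * t)) = V.valuation y ^ (k * q ^ 3) := by
    rw [show k * (q * t) = t * (k * q) by ring, pow_mul, h3, ← pow_mul]
    congr 1; ring
  rw [e1, e3, dg, pow_add, pow_add]

theorem Crv.w_NM (C : Crv K p a q t e x y z) (V : ValuationSubring F)
    (hK : ∀ c : K, algebraMap K F c ∈ V) (hx : x ∉ V) {n : ℕ} {f : F} (hf : f ∈ NM K q t x y z n) :
    V.valuation f ^ (q * t) < V.valuation y ^ n := by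
  have hq := C.q2
  have ht := C.ht
  have hqt : q * t ≠ 0 := by positivity
  obtain ⟨h1, h2, h3⟩ := C.w_x V hx
  refine Submodule.span_induction ?_ ?_ ?_ ?_ hf
  · rintro _ ⟨i, j, k, hj, hk, hd, rfl⟩
    rw [C.w_mon V hx]
    exact pow_lt_pow_right₀ h2 hd
  · simp only [map_zero, zero_pow hqt]
    exact zero_lt_iff.2 (pow_ne_zero _ (zero_lt_one.trans h2).ne')
  · intro f g _ _ hf hg
    rcases le_max_iff.1 (V.valuation.map_add f g) with h | h
    · exact (pow_le_pow_left₀ zero_le h _).trans_lt hf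
    · exact (pow_le_pow_left₀ zero_le h _).trans_lt hg
  · intro c f _ hf
    by_cases hc : c = 0
    · simp only [hc, zero_smul, map_zero, zero_pow hqt]
      exact zero_lt_iff.2 (pow_ne_zero _ (zero_lt_one.trans h2).ne')
    · rw [Algebra.smul_def, map_mul, V_const V hK hc, one_mul]; exact hf

theorem Crv.w_lead (C : Crv K p a q t e x y z) (V : ValuationSubring F)
    (hK : ∀ c : K, algebraMap K F c ∈ V) (hx : x ∉ V) {n : ℕ} {f : F} (hf : Lead K q t x y z f n) :
    V.valuation f ^ (q * t) = V.valuation y ^ n := by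
  obtain ⟨i, j, k, hj, hk, hd, c, hc, hm⟩ := hf
  have h1 := C.w_NM V hK hx hm
  have h2 := C.w_mon V hx i j k
  rw [hd] at h2
  rw [← h2] at h1
  have h3 : V.valuation (c • (x ^ i * y ^ j * z ^ k)) = V.valuation (x ^ i * y ^ j * z ^ k) := by
    rw [Algebra.smul_def, map_mul, V_const V hK hc, one_mul]
  have h4 := lt_of_pow_lt_pow_left₀ _ zero_le h1
  rw [← h3] at h4
  have h5 := Valuation.map_add_eq_of_lt_left V.valuation h4
  rw [add_sub_cancel] at h5
  rw [h5, h3, h2]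

theorem Crv.x_trans [IsAlgClosed K] (C : Crv K p a q t e x y z) (c : K) : x ≠ algebraMap K F c := by
  intro h
  have ⟨b, hb⟩ := IsAlgClosed.exists_pow_nat_eq ((c + 1) ^ q + (c + 1)) (n := q + 1) (by omega)
  have ⟨d, hd⟩ := IsAlgClosed.exists_pow_nat_eq (b ^ (q ^ 2) - b) (n := t) (by have := C.ht; omega)
  obtain ⟨φ, h1, -, -⟩ := C.lift (algebraMap K F (c + 1)) (algebraMap K F b) (algebraMap K F d)
    (by rw [← map_pow, hd]; simp) (by rw [← map_pow, hb]; simp)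
  have h2 : (⟨x, Algebra.subset_adjoin (by simp)⟩ : Algebra.adjoin K {x, y, z}) =
    algebraMap K _ c := by
    apply Subtype.ext; exact h
  rw [h2, AlgHom.commutes] at h1
  have := (algebraMap K F).injective h1
  simp at this

theorem Crv.exists_V [IsAlgClosed K] (C : Crv K p a q t e x y z) :
    ∃ V : ValuationSubring F, (∀ c : K, algebraMap K F c ∈ V) ∧ x ∉ V := by
  by_contra hcon
  push Not at hcon
  have h1 : x ∈ (⨅ V : {V : ValuationSubring F // Set.range (algebraMap K F) ⊆ V.toSubring}, V.1.toSubring) := by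
    rw [Subring.mem_iInf]
    rintro ⟨V, hV⟩
    exact hcon V (fun c => hV ⟨c, rfl⟩)
  rw [iInf_valuationSubring_superset] at h1
  have h2 : IsIntegral (Subring.closure (Set.range (algebraMap K F))) x := h1
  have h3 : IsIntegral (algebraMap K F).range x := by
    have : Subring.closure (Set.range (algebraMap K F)) = (algebraMap K F).range := by
      rw [← RingHom.coe_range, Subring.closure_eq]
    rwa [this] at h2
  have h4 : IsIntegral K x := by
    obtain ⟨P, hP, hx⟩ := h3
    obtain ⟨Q, hQ1, hQ2, hQ3⟩ := Polynomial.lifts_and_natDegree_eq_and_monic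
      (f := (algebraMap K F).rangeRestrict) (p := P)
      (by rw [Polynomial.lifts_iff_coeff_lifts]; intro n; exact RingHom.rangeRestrict_surjective _ _) hP
    refine ⟨Q, hQ3, ?_⟩
    rw [← hQ1, Polynomial.eval₂_map] at hx
    exact hx
  have h5 := IsAlgClosed.degree_eq_one_of_irreducible K (minpoly.irreducible h4)
  obtain ⟨c, hc⟩ := minpoly.mem_range_of_degree_eq_one K x h5
  exact C.x_trans c hc.symm

/-- the order function at the place at infinity -/
structure Inf (K : Type) {F : Type} [Field K] [Field F] [Algebra K F] (q t : ℕ) (x y z : F)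
    (v : F → ℤ) : Prop where
  ov : OV K v
  lead : ∀ f n, Lead K q t x y z f n → E v (-n) f
  mem : ∀ V : ValuationSubring F, (∀ c : K, algebraMap K F c ∈ V) → x ∉ V → ∀ f, f ∈ V ↔ G v 0 f

theorem Crv.lead_one (C : Crv K p a q t e x y z) {n : ℕ} {f : F} (hf : Lead K q t x y z f n)
    [IsAlgClosed K] : f ≠ 0 := by
  rintro rfl
  obtain ⟨V, hV, hx⟩ := C.exists_V
  have h := C.w_lead V hV hx hf
  have h2 := (C.w_x V hx).2.1
  have hq := C.q2
  have ht := C.ht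
  rw [map_zero, zero_pow (by positivity)] at h
  exact pow_ne_zero _ (zero_lt_one.trans h2).ne' h.symm

theorem Crv.exists_inf [IsAlgClosed K] (C : Crv K p a q t e x y z) : ∃ v : F → ℤ, Inf K q t x y z v := by
  have hq := C.q2
  have ht := C.ht
  have hqt : q * t ≠ 0 := by positivity
  have key : ∀ f : F, f ≠ 0 → ∃ r s : F, ∃ n m : ℕ, f = r / s ∧ Lead K q t x y z r n ∧ Lead K q t x y z s m := by
    intro f hf
    obtain ⟨r, hr, s, hs, hs0, rfl⟩ := C.frac f
    have hr0 : r ≠ 0 := by rintro rfl; simp at hf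
    obtain ⟨n, hn⟩ := C.lead hr hr0
    obtain ⟨m, hm⟩ := C.lead hs hs0
    exact ⟨r, s, n, m, rfl, hn, hm⟩
  have key2 : ∀ f : F, ∃ r s : F, ∃ n m : ℕ, f ≠ 0 → f = r / s ∧ Lead K q t x y z r n ∧ Lead K q t x y z s m := by
    intro f
    by_cases hf : f = 0
    · exact ⟨0, 0, 0, 0, fun h => absurd hf h⟩
    · obtain ⟨r, s, n, m, h⟩ := key f hf
      exact ⟨r, s, n, m, fun _ => h⟩
  choose r s n m hk using key2
  let v : F → ℤ := fun f => (m f : ℤ) - n f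
  have spec : ∀ V : ValuationSubring F, (∀ c : K, algebraMap K F c ∈ V) → x ∉ V → ∀ f, f ≠ 0 →
      V.valuation f ^ (q * t) = V.valuation y ^ (- v f) := by
    intro V hK hx f hf
    obtain ⟨h1, h2, h3⟩ := hk f hf
    have hy := (C.w_x V hx).2.1
    have hy0 : V.valuation y ≠ 0 := (zero_lt_one.trans hy).ne'
    have h4 := C.w_lead V hK hx h2
    have h5 := C.w_lead V hK hx h3
    conv_lhs => rw [h1]
    rw [map_div₀, div_pow, h4, h5, neg_sub, zpow_sub₀ hy0, zpow_natCast, zpow_natCast]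
  obtain ⟨V, hK, hx⟩ := C.exists_V
  have hy := (C.w_x V hx).2.1
  have hy0 : V.valuation y ≠ 0 := (zero_lt_one.trans hy).ne'
  have inj : ∀ a b : ℤ, V.valuation y ^ a = V.valuation y ^ b → a = b := fun a b h =>
    zpow_right_injective₀ (zero_lt_one.trans hy) hy.ne' h
  have hlead : ∀ f n, Lead K q t x y z f n → E v (-n) f := by
    intro f n hf
    have hf0 := C.lead_one hf
    refine ⟨hf0, ?_⟩
    have h1 := C.w_lead V hK hx hf
    rw [spec V hK hx f hf0, ← zpow_natCast] at h1
    have := inj _ _ h1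
    omega
  have hmul : ∀ f g, f ≠ 0 → g ≠ 0 → v (f * g) = v f + v g := by
    intro f g hf hg
    have h1 := spec V hK hx _ (mul_ne_zero hf hg)
    rw [map_mul, mul_pow, spec V hK hx f hf, spec V hK hx g hg, ← zpow_add₀ hy0] at h1
    have := inj _ _ h1
    omega
  refine ⟨v, ⟨hmul, ?_, ?_, ?_⟩, hlead, ?_⟩
  · intro f g hf hg hfg
    rcases le_max_iff.1 (V.valuation.map_add f g) with h | h
    · have h := pow_le_pow_left₀ zero_le h (q * t)
      rw [spec V hK hx f hf, spec V hK hx _ hfg, zpow_le_zpow_iff_right₀ hy] at h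
      omega
    · have h := pow_le_pow_left₀ zero_le h (q * t)
      rw [spec V hK hx g hg, spec V hK hx _ hfg, zpow_le_zpow_iff_right₀ hy] at h
      omega
  · intro c hc
    have h := spec V hK hx (algebraMap K F c) (by simpa using hc)
    rw [V_const V hK hc, one_pow, ← zpow_zero (V.valuation y)] at h
    have := inj _ _ h
    omega
  · rintro f (hf | hf)
    · exact ⟨0, Or.inl (by simp [hf])⟩
    by_cases hf0 : f = 0
    · exact ⟨0, Or.inl (by simp [hf0])⟩
    rcases lt_or_eq_of_le hf with h | h
    · exact ⟨0, Or.inr (by simp only [map_zero, sub_zero]; omega)⟩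
    obtain ⟨h1, h2, h3⟩ := hk f hf0
    have hmn : m f = n f := by simp only [v] at h; omega
    rw [hmn] at h3
    have hs0 := C.lead_one h3
    have hvs := hlead _ _ h3
    generalize hr : r f = r' at *
    generalize hs : s f = s' at *
    obtain ⟨i, j, k, hj, hk1, hd, c, hc, hm1⟩ := h2
    obtain ⟨i', j', k', hj', hk', hd', c', hc', hm'⟩ := h3
    obtain ⟨rfl, rfl, rfl⟩ := dg_inj (by omega) (by omega) C.cop hj hk1 hj' hk' (hd.trans hd'.symm)
    refine ⟨c / c', ?_⟩
    have h4 : r' - (c / c') • s' ∈ NM K q t x y z (n f) := by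
      have := Submodule.sub_mem _ hm1 (Submodule.smul_mem _ (c / c') hm')
      convert this using 1
      rw [smul_sub, smul_smul, div_mul_cancel₀ _ hc']
      ring
    have h5 : f - algebraMap K F (c / c') = (r' - (c / c') • s') * s'⁻¹ := by
      rw [h1, Algebra.smul_def]; field_simp
    by_cases h0 : r' - (c / c') • s' = 0
    · left; rw [h5, h0, zero_mul]
    · right
      obtain ⟨n1, hn1, hl⟩ := C.lead_of_NM _ h4 h0
      have h6 := hlead _ _ hl
      have h7 := hmul _ _ h0 (inv_ne_zero hs0)
      have h8 := hmul _ _ hs0 (inv_ne_zero hs0)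
      have h9 : v 1 = 0 := by
        have := hmul 1 1 one_ne_zero one_ne_zero
        rw [mul_one] at this
        omega
      rw [mul_inv_cancel₀ hs0] at h8
      rw [h5, h7, h6.2]
      have := hvs.2
      omega
  · intro V hK hx f
    have hy := (C.w_x V hx).2.1
    by_cases hf0 : f = 0
    · simp [hf0, G_zero]
    have h := spec V hK hx f hf0
    rw [← V.valuation_le_one_iff]
    rw [← pow_le_one_iff hqt, h]
    simp only [G, hf0, false_or]
    rw [← zpow_zero (V.valuation y), zpow_le_zpow_iff_right₀ hy]
    omega

end
end YC1


namespace YC1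

/-- the coordinate ring -/
abbrev Rg (K : Type) {F : Type} [Field K] [Field F] [Algebra K F] (x y z : F) : Subalgebra K F :=
  Algebra.adjoin K {x, y, z}

section
variable {K F : Type} [Field K] [Field F] [Algebra K F] {p a q t e : ℕ} {x y z : F}

theorem x_mem : x ∈ Rg K x y z := Algebra.subset_adjoin (by simp)
theorem y_mem : y ∈ Rg K x y z := Algebra.subset_adjoin (by simp)
theorem z_mem : z ∈ Rg K x y z := Algebra.subset_adjoin (by simp)
theorem c_mem (c : K) : algebraMap K F c ∈ Rg K x y z := Subalgebra.algebraMap_mem _ c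

theorem Crv.pt_y (C : Crv K p a q t e x y z) {b c : K} (h : c ^ t = b ^ (q ^ 2) - b) :
    (1 - (y - algebraMap K F b) ^ (q ^ 2 - 1)) * (y - algebraMap K F b) =
      -(z ^ t - (algebraMap K F c) ^ t) := by
  have hq := C.q2
  have h1 : q ^ 2 - 1 + 1 = q ^ 2 := by have : 0 < q ^ 2 := by positivity
                                        omega
  rw [sub_mul, ← pow_succ, h1, C.frobF_sub, C.r1, ← map_pow (algebraMap K F) c, h]
  simp only [map_sub, map_pow]
  ring

theorem Crv.pt_x (C : Crv K p a q t e x y z) {a' b : K} (h : b ^ (q + 1) = a' ^ q + a') :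
    (1 + (x - algebraMap K F a') ^ (q - 1)) * (x - algebraMap K F a') =
      y ^ (q + 1) - (algebraMap K F b) ^ (q + 1) := by
  have hq := C.q2
  have h1 : q - 1 + 1 = q := by omega
  have h2 := C.frobF_sub 1 x (algebraMap K F a')
  rw [pow_one] at h2
  rw [add_mul, ← pow_succ, h1, h2, C.r2, ← map_pow (algebraMap K F) b, h]
  simp only [map_add, map_pow]
  ring

/-- a unit at the point `(a,b,c)` -/
def uu (K : Type) {F : Type} [Field K] [Field F] [Algebra K F] (q : ℕ) (x y : F) (a b : K) : F :=
  (1 - (y - algebraMap K F b) ^ (q ^ 2 - 1)) * (1 + (x - algebraMap K F a) ^ (q - 1))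

theorem uu_mem (a b : K) : uu K q x y a b ∈ Rg K x y z := by
  have hx : x ∈ Rg K x y z := x_mem
  have hy : y ∈ Rg K x y z := y_mem
  exact mul_mem (sub_mem (one_mem _) (pow_mem (sub_mem hy (c_mem b)) _))
    (add_mem (one_mem _) (pow_mem (sub_mem hx (c_mem a)) _))

/-- every function is, up to a local unit, a constant plus a multiple of `z - c` -/
theorem Crv.pt (C : Crv K p a q t e x y z) {a' b c : K} (h1 : c ^ t = b ^ (q ^ 2) - b)
    (h2 : b ^ (q + 1) = a' ^ q + a') {f : F} (hf : f ∈ Rg K x y z) :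
    ∃ d : K, ∃ g ∈ Rg K x y z, uu K q x y a' b * (f - algebraMap K F d) = (z - algebraMap K F c) * g := by
  have hx : x ∈ Rg K x y z := x_mem
  have hy : y ∈ Rg K x y z := y_mem
  have hz : z ∈ Rg K x y z := z_mem
  have hu : uu K q x y a' b ∈ Rg K x y z := uu_mem a' b
  have hu1 : 1 - (y - algebraMap K F b) ^ (q ^ 2 - 1) ∈ Rg K x y z :=
    sub_mem (one_mem _) (pow_mem (sub_mem hy (c_mem b)) _)
  have hu2 : 1 + (x - algebraMap K F a') ^ (q - 1) ∈ Rg K x y z :=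
    add_mem (one_mem _) (pow_mem (sub_mem hx (c_mem a')) _)
  have gs : ∀ (f : F) (d : K) (n : ℕ), f ∈ Rg K x y z → ∃ g ∈ Rg K x y z,
      f ^ n - (algebraMap K F d) ^ n = (f - algebraMap K F d) * g := by
    intro f d n hf
    refine ⟨∑ i ∈ Finset.range n, f ^ i * algebraMap K F d ^ (n - 1 - i), ?_, ?_⟩
    · exact sum_mem (fun i _ => mul_mem (pow_mem hf _) (pow_mem (c_mem d) _))
    · rw [mul_comm, Commute.geom_sum₂_mul (Commute.all _ _)]
  obtain ⟨gz, hgz, hgz1⟩ := gs z c t hz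
  obtain ⟨gy, hgy, hgy1⟩ := gs y b (q + 1) hy
  have ey := C.pt_y h1
  have ex := C.pt_x h2
  refine Algebra.adjoin_induction (p := fun f _ => ∃ d : K, ∃ g ∈ Rg K x y z,
    uu K q x y a' b * (f - algebraMap K F d) = (z - algebraMap K F c) * g) ?_ ?_ ?_ ?_ hf
  · rintro f hf
    simp only [Set.mem_insert_iff, Set.mem_singleton_iff] at hf
    rcases hf with hf | hf | hf
    · subst hf
      refine ⟨a', -(gz * gy), neg_mem (mul_mem hgz hgy), ?_⟩
      rw [uu, mul_assoc, ex, hgy1, ← mul_assoc, ey, hgz1]; ring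
    · subst hf
      refine ⟨b, -(gz * (1 + (x - algebraMap K F a') ^ (q - 1))), neg_mem (mul_mem hgz hu2), ?_⟩
      rw [uu, mul_right_comm, ey, hgz1]; ring
    · subst hf
      exact ⟨c, uu K q x y a' b, hu, mul_comm _ _⟩
  · intro d
    exact ⟨d, 0, zero_mem _, by simp⟩
  · rintro f g _ _ ⟨d, r, hr, h⟩ ⟨d', r', hr', h'⟩
    refine ⟨d + d', r + r', add_mem hr hr', ?_⟩
    rw [map_add, mul_add, ← h, ← h']; ring
  · rintro f g hf hg ⟨d, r, hr, h⟩ ⟨d', r', hr', h'⟩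
    refine ⟨d * d', r * g + algebraMap K F d * r', add_mem (mul_mem hr hg) (mul_mem (c_mem d) hr'), ?_⟩
    rw [map_mul, mul_add, ← mul_assoc, ← h, mul_left_comm, ← h']; ring

theorem Crv.isFrac (C : Crv K p a q t e x y z) : IsFractionRing (Rg K x y z) F := by
  refine IsFractionRing.of_field _ _ ?_
  intro f
  obtain ⟨r, hr, s, hs, _, h⟩ := C.frac f
  exact ⟨⟨r, hr⟩, ⟨s, hs⟩, h⟩

theorem fgRg : (Rg K x y z).FG := by
  classical exact ⟨{x, y, z}, by simp [Rg]⟩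

theorem Crv.intClosed [IsAlgClosed K] (C : Crv K p a q t e x y z) : IsIntegrallyClosed (Rg K x y z) := by
  have hq := C.q2
  have : IsNoetherianRing (Rg K x y z) := isNoetherianRing_of_fg fgRg
  have : Algebra.FiniteType K (Rg K x y z) := Subalgebra.fg_iff_finiteType _ |>.1 fgRg
  apply IsIntegrallyClosed.of_localization_maximal
  intro P _ hP
  have hfin : Module.Finite K (Rg K x y z ⧸ P) := by
    let _ := Ideal.Quotient.field P
    exact finite_of_finite_type_of_isJacobsonRing K _
  have hbij := IsAlgClosed.algebraMap_bijective_of_isIntegral (k := K) (K := Rg K x y z ⧸ P)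
  have hres : ∀ f : Rg K x y z, ∃ d : K, f - algebraMap K _ d ∈ P := by
    intro f
    obtain ⟨d, hd⟩ := hbij.2 (Ideal.Quotient.mk P f)
    refine ⟨d, ?_⟩
    rw [← Ideal.Quotient.eq_zero_iff_mem, map_sub, ← hd]
    exact sub_self _
  have hcP : ∀ d : K, algebraMap K (Rg K x y z) d ∈ P → d = 0 := by
    intro d hd
    by_contra h0
    apply hP.ne_top
    exact Ideal.eq_top_of_isUnit_mem _ hd ((IsUnit.mk0 d h0).map _)
  obtain ⟨a', ha⟩ := hres ⟨x, x_mem⟩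
  obtain ⟨b, hb⟩ := hres ⟨y, y_mem⟩
  obtain ⟨c, hc⟩ := hres ⟨z, z_mem⟩
  have r1 : (⟨z, z_mem⟩ : Rg K x y z) ^ t = ⟨y, y_mem⟩ ^ (q ^ 2) - ⟨y, y_mem⟩ := by
    apply Subtype.ext; simpa using C.r1
  have r2 : (⟨y, y_mem⟩ : Rg K x y z) ^ (q + 1) = ⟨x, x_mem⟩ ^ q + ⟨x, x_mem⟩ := by
    apply Subtype.ext; simpa using C.r2
  have h1 : c ^ t = b ^ (q ^ 2) - b := by
    apply hbij.1
    have e1 := (Ideal.Quotient.mk_eq_mk_iff_sub_mem (I := P) _ _).2 hb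
    have e2 := (Ideal.Quotient.mk_eq_mk_iff_sub_mem (I := P) _ _).2 hc
    have e3 := congrArg (Ideal.Quotient.mk P) r1
    rw [map_pow, map_sub, map_pow, e1, e2] at e3
    rw [map_sub, map_pow, map_pow]
    exact e3
  have h2 : b ^ (q + 1) = a' ^ q + a' := by
    apply hbij.1
    have e1 := (Ideal.Quotient.mk_eq_mk_iff_sub_mem (I := P) _ _).2 hb
    have e2 := (Ideal.Quotient.mk_eq_mk_iff_sub_mem (I := P) _ _).2 ha
    have e3 := congrArg (Ideal.Quotient.mk P) r2
    rw [map_pow, map_add, map_pow, e1, e2] at e3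
    rw [map_add, map_pow, map_pow]
    exact e3
  let u : Rg K x y z := ⟨uu K q x y a' b, uu_mem a' b⟩
  have hu1 : u = (1 - (⟨y, y_mem⟩ - algebraMap K _ b) ^ (q ^ 2 - 1)) *
      (1 + (⟨x, x_mem⟩ - algebraMap K _ a') ^ (q - 1)) := by
    apply Subtype.ext; simp [u, uu]
  have hu : u ∉ P := by
    rw [hu1]
    intro h
    have h01 : (1 : Rg K x y z) ∉ P := P.ne_top_iff_one.1 hP.ne_top
    have hq2 : q ^ 2 - 1 ≠ 0 := by
      have : 2 ^ 2 ≤ q ^ 2 := Nat.pow_le_pow_left hq 2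
      omega
    rcases hP.isPrime.mem_or_mem h with h | h
    · apply h01
      have := P.add_mem h (P.pow_mem_of_mem hb (q ^ 2 - 1) (by omega))
      simpa using this
    · apply h01
      have := P.sub_mem h (P.pow_mem_of_mem ha (q - 1) (by omega))
      simpa using this
  have : IsDomain (Localization.AtPrime P) := inferInstance
  have : IsNoetherianRing (Localization.AtPrime P) :=
    IsLocalization.isNoetherianRing P.primeCompl _ inferInstance
  have hprin : (IsLocalRing.maximalIdeal (Localization.AtPrime P)).IsPrincipal := by
    refine ⟨algebraMap (Rg K x y z) _ (⟨z, z_mem⟩ - algebraMap K _ c), ?_⟩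
    apply le_antisymm
    · rw [← Localization.AtPrime.map_eq_maximalIdeal, Ideal.map_le_iff_le_comap]
      intro f hf
      obtain ⟨d, g, hg, hfg⟩ := C.pt h1 h2 f.2
      have hfg' : u * (f - algebraMap K _ d) = (⟨z, z_mem⟩ - algebraMap K _ c) * ⟨g, hg⟩ := by
        apply Subtype.ext; simpa [u] using hfg
      have hd : d = 0 := by
        apply hcP
        have : u * (f - algebraMap K _ d) ∈ P := by
          rw [hfg']; exact P.mul_mem_right _ hc
        have := (hP.isPrime.mem_or_mem this).resolve_left hu
        have := P.sub_mem hf this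
        simpa using this
      rw [hd, map_zero, sub_zero] at hfg'
      rw [Ideal.mem_comap]
      change _ ∈ Ideal.span _
      have hun : IsUnit (algebraMap (Rg K x y z) (Localization.AtPrime P) u) :=
        IsLocalization.map_units (M := P.primeCompl) _ ⟨u, hu⟩
      rw [← Ideal.unit_mul_mem_iff_mem _ hun, ← map_mul, hfg', map_mul]
      exact Ideal.mul_mem_right _ _ (Ideal.mem_span_singleton_self _)
    · rw [← Localization.AtPrime.map_eq_maximalIdeal]
      refine (Submodule.span_singleton_le_iff_mem _ _).2 (Ideal.mem_map_of_mem _ hc)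
  have hfin2 := (tfae_of_isNoetherianRing_of_isLocalRing_of_isDomain
    (Localization.AtPrime P)).out 4 3
  exact (hfin2.1 hprin).1

/-- the coordinate ring is the intersection of the valuation rings containing it -/
theorem Crv.mem_of_V [IsAlgClosed K] (C : Crv K p a q t e x y z) {h : F}
    (hV : ∀ V : ValuationSubring F, (∀ c : K, algebraMap K F c ∈ V) → (∀ f ∈ Rg K x y z, f ∈ V) → h ∈ V) :
    h ∈ Rg K x y z := by
  have h1 : h ∈ (⨅ V : {V : ValuationSubring F // (Rg K x y z : Set F) ⊆ V.toSubring}, V.1.toSubring) := by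
    rw [Subring.mem_iInf]
    rintro ⟨V, hV'⟩
    exact hV V (fun c => hV' (c_mem c)) (fun f hf => hV' hf)
  rw [iInf_valuationSubring_superset] at h1
  have h2 : IsIntegral (Subring.closure (Rg K x y z : Set F)) h := h1
  have h3 : IsIntegral (Rg K x y z) h := by
    have : Subring.closure (Rg K x y z : Set F) = (Rg K x y z).toSubring :=
      Subring.closure_eq (Rg K x y z).toSubring
    rw [this] at h2
    exact h2
  have := C.isFrac
  have := C.intClosed
  obtain ⟨r, hr⟩ := IsIntegrallyClosed.isIntegral_iff.1 h3
  rw [← hr]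
  exact r.2

end
end YC1


namespace YC1

section
variable {K F : Type} [Field K] [Field F] [Algebra K F] {p a q t e : ℕ} {x y z : F} {v : F → ℤ}

theorem in_K [IsAlgClosed K] {f : F} {n : ℕ} (hn : n ≠ 0) {c : K} (h : f ^ n = algebraMap K F c) :
    ∃ d : K, f = algebraMap K F d := by
  have h4 : IsIntegral K f := by
    refine IsIntegral.of_pow (Nat.pos_of_ne_zero hn) ?_
    rw [h]; exact isIntegral_algebraMap
  have h5 := IsAlgClosed.degree_eq_one_of_irreducible K (minpoly.irreducible h4)
  obtain ⟨c, hc⟩ := minpoly.mem_range_of_degree_eq_one K f h5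
  exact ⟨c, hc.symm⟩

theorem OV.G_sum (h : OV K v) {ι : Type} (s : Finset ι) (f : ι → F) (n : ℤ)
    (hf : ∀ i ∈ s, G v n (f i)) : G v n (∑ i ∈ s, f i) := by
  classical
  induction s using Finset.induction_on with
  | empty => exact Or.inl (by simp)
  | insert i s hi ih =>
    rw [Finset.sum_insert hi]
    exact h.G_add (hf i (by simp)) (ih (fun j hj => hf j (by simp [hj])))

theorem OV.indep (h : OV K v) {ι : Type} [Fintype ι] (c : ι → K) (f : ι → F) (n : ι → ℤ)
    (hf : ∀ i, E v (n i) (f i)) (hn : Function.Injective n) (h0 : ∑ i, algebraMap K F (c i) * f i = 0) :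
    ∀ i, c i = 0 := by
  classical
  by_contra hcon
  push Not at hcon
  obtain ⟨i0, hi0⟩ := hcon
  obtain ⟨i, hi, hmin⟩ := Finset.exists_min_image (Finset.univ.filter (fun i => c i ≠ 0)) n
    ⟨i0, by simpa using hi0⟩
  rw [← Finset.add_sum_erase _ _ (Finset.mem_univ i)] at h0
  have hi' : c i ≠ 0 := by simpa using hi
  have h1 : E v (n i) (algebraMap K F (c i) * f i) := by
    simpa using h.E_mul (h.E_const hi') (hf i)
  have h2 : G v (n i + 1) (∑ j ∈ Finset.univ.erase i, algebraMap K F (c j) * f j) := by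
    apply h.G_sum
    intro j hj
    by_cases hc : c j = 0
    · left; simp [hc]
    · have h3 := hmin j (by simpa using hc)
      have h4 : n i ≠ n j := fun h => (Finset.ne_of_mem_erase hj) (hn h.symm)
      have h5 : G v (0 + n j) (algebraMap K F (c j) * f j) := h.G_mul (h.G_const _) (hf j).toG
      exact h5.mono (by omega)
  exact (h.E_add h1 h2).1 h0

theorem lead_mon {i j k : ℕ} (hj : j ≤ q) (hk : k < t) :
    Lead K q t x y z (x ^ i * y ^ j * z ^ k) (dg q t i j k) :=
  ⟨i, j, k, hj, hk, rfl, 1, one_ne_zero, by simp⟩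

theorem Crv.Ex (C : Crv K p a q t e x y z) (I : Inf K q t x y z v) : E v (-((q + 1) * t : ℤ)) x := by
  have := I.lead _ _ (lead_mon (i := 1) (j := 0) (k := 0) (by omega) (by have := C.ht; omega))
  simpa [dg] using this

theorem Crv.Ey (C : Crv K p a q t e x y z) (I : Inf K q t x y z v) : E v (-(q * t : ℤ)) y := by
  have := I.lead _ _ (lead_mon (i := 0) (j := 1) (k := 0) (by have := C.q2; omega) (by have := C.ht; omega))
  simpa [dg] using this

theorem Crv.Ez (C : Crv K p a q t e x y z) (I : Inf K q t x y z v) : E v (-(q ^ 3 : ℤ)) z := by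
  have := I.lead _ _ (lead_mon (i := 0) (j := 0) (k := 1) (by have := C.q2; omega) (by have := C.ht; omega))
  simpa [dg] using this

theorem Crv.exists_pi (C : Crv K p a q t e x y z) (I : Inf K q t x y z v) : ∃ π, E v 1 π := by
  have h := I.ov
  have h1 : E v t (y / x) := by
    have := h.E_div (C.Ey I) (C.Ex I)
    convert this using 1; ring
  have h2 : E v (q ^ 3 : ℤ) z⁻¹ := by
    have := h.E_inv (C.Ez I)
    convert this using 1; ring
  have hc : IsCoprime (t : ℤ) ((q : ℤ) ^ 3) := by
    have : Nat.Coprime t (q ^ 3) := C.cop.pow_right 3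
    have := Nat.isCoprime_iff_coprime.2 this
    simpa using this
  obtain ⟨A, B, hAB⟩ := hc
  refine ⟨(y / x) ^ A * (z⁻¹) ^ B, ?_⟩
  have := h.E_mul (h.E_zpow h1 A) (h.E_zpow h2 B)
  rwa [hAB] at this

theorem Crv.Vinf [IsAlgClosed K] (C : Crv K p a q t e x y z) (I : Inf K q t x y z v) :
    ∃ V : ValuationSubring F, (∀ c : K, algebraMap K F c ∈ V) ∧ ∀ f, f ∈ V ↔ G v 0 f := by
  obtain ⟨V, h1, h2⟩ := C.exists_V
  exact ⟨V, h1, I.mem V h1 h2⟩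

/-- trichotomy for transported valuation rings -/
theorem Crv.dich (C : Crv K p a q t e x y z) (I : Inf K q t x y z v)
    (V : ValuationSubring F) (hK : ∀ c : K, algebraMap K F c ∈ V) (σ : F ≃ₐ[K] F) :
    (∀ f ∈ Rg K x y z, σ f ∈ V) ∨ (∀ f, σ f ∈ V ↔ G v 0 f) := by
  let W := V.comap (σ : F →+* F)
  have hW : ∀ f, f ∈ W ↔ σ f ∈ V := fun f => Iff.rfl
  have hWK : ∀ c : K, algebraMap K F c ∈ W := fun c => by rw [hW, AlgEquiv.commutes]; exact hK c
  by_cases hx : x ∈ W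
  · left; intro f hf; exact C.V_of_x W hWK hx f hf
  · right; intro f; exact I.mem W hWK hx f

theorem Crv.dich1 (C : Crv K p a q t e x y z) (I : Inf K q t x y z v)
    (V : ValuationSubring F) (hK : ∀ c : K, algebraMap K F c ∈ V) :
    (∀ f ∈ Rg K x y z, f ∈ V) ∨ (∀ f, f ∈ V ↔ G v 0 f) := by
  by_cases hx : x ∈ V
  · left; intro f hf; exact C.V_of_x V hK hx f hf
  · right; intro f; exact I.mem V hK hx f

theorem Crv.x_not (C : Crv K p a q t e x y z) (I : Inf K q t x y z v) : ¬ G v 0 x := by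
  intro h
  have h1 := (C.Ex I).not_G h
  have h2 := C.q2
  have h3 := C.ht
  have : (0 : ℤ) < (q + 1) * t := by positivity
  omega

/-- elements of the coordinate ring with bounded pole order -/
theorem Crv.mem_NM_of [IsAlgClosed K] (C : Crv K p a q t e x y z) (I : Inf K q t x y z v) {f : F}
    (hf : f ∈ Rg K x y z) {D : ℕ} (h : G v (-D) f) : f ∈ NM K q t x y z (D + 1) := by
  by_cases h0 : f = 0
  · rw [h0]; exact Submodule.zero_mem _
  obtain ⟨n, hn⟩ := C.lead hf h0
  have h1 := (I.lead _ _ hn).not_G h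
  exact NM_mono (by omega) hn.mem

theorem Crv.const_of [IsAlgClosed K] (C : Crv K p a q t e x y z) (I : Inf K q t x y z v) {f : F}
    (hf : f ∈ Rg K x y z) (h : G v 0 f) : ∃ c : K, f = algebraMap K F c := by
  have h1 := C.mem_NM_of I hf (D := 0) (by simpa using h)
  have hq := C.q2
  have ht := C.ht
  refine Submodule.span_induction ?_ ?_ ?_ ?_ h1
  · rintro _ ⟨i, j, k, hj, hk, hd, rfl⟩
    refine ⟨1, ?_⟩
    have h0 : i * ((q + 1) * t) = 0 ∧ j * (q * t) = 0 ∧ k * q ^ 3 = 0 := by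
      unfold dg at hd
      omega
    have hq0 : q ≠ 0 := by omega
    have ht0 : t ≠ 0 := by omega
    simp only [mul_eq_zero, hq0, ht0, or_false, pow_eq_zero_iff, ne_eq, OfNat.ofNat_ne_zero,
      not_false_eq_true, Nat.add_eq_zero_iff, one_ne_zero, and_false] at h0
    obtain ⟨rfl, rfl, rfl⟩ := h0
    simp
  · exact ⟨0, by simp⟩
  · rintro f g _ _ ⟨c, rfl⟩ ⟨d, rfl⟩; exact ⟨c + d, by simp⟩
  · rintro b f _ ⟨c, rfl⟩; exact ⟨b * c, by rw [Algebra.smul_def, map_mul]⟩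

/-- automorphisms fixing the place at infinity -/
def Bset (K : Type) {F : Type} [Field K] [Field F] [Algebra K F] (v : F → ℤ) (σ : F ≃ₐ[K] F) : Prop :=
  ∀ f, G v 0 (σ f) ↔ G v 0 f

theorem Crv.B_v (C : Crv K p a q t e x y z) (I : Inf K q t x y z v) {σ : F ≃ₐ[K] F}
    (hσ : Bset K v σ) {f : F} (hf : f ≠ 0) : v (σ f) = v f := by
  have h := I.ov
  obtain ⟨π, hπ⟩ := C.exists_pi I
  have hu : ∀ u, u ≠ 0 → v u = 0 → v (σ u) = 0 := by
    intro u hu hv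
    have h0 : σ u ≠ 0 := by simpa using hu
    have h1 := ((hσ u).2 (Or.inr hv.ge)).le h0
    have h2 : G v 0 (σ u⁻¹) := (hσ u⁻¹).2 (Or.inr (by rw [h.v_inv hu, hv]; omega))
    have h3 := h2.le (by simpa using hu)
    rw [map_inv₀, h.v_inv h0] at h3
    omega
  have hs : σ π ≠ 0 := by simpa using hπ.1
  have hall : ∀ f, f ≠ 0 → v (σ f) = v f * v (σ π) := by
    intro f hf
    have h1 : E v (v f - v f * 1) (f / π ^ (v f)) := h.E_div ⟨hf, rfl⟩ (h.E_zpow hπ _)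
    have h2 := hu _ h1.1 (by rw [h1.2]; ring)
    have h3 : σ f = σ (f / π ^ (v f)) * (σ π) ^ (v f) := by
      rw [← map_zpow₀, ← map_mul, div_mul_cancel₀ _ (zpow_ne_zero _ hπ.1)]
    have h4 : E v _ ((σ π) ^ (v f)) := h.E_zpow ⟨hs, rfl⟩ _
    rw [h3, h.mul _ _ ((map_ne_zero σ).2 h1.1) h4.1, h2, h4.2]
    ring
  have h1 := hall (σ.symm π) (by simpa using hπ.1)
  rw [σ.apply_symm_apply, hπ.2] at h1
  have h2 := ((hσ π).2 (Or.inr (by rw [hπ.2]; omega))).le hs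
  have h3 : v (σ π) = 1 := by
    have : v (σ π) ∣ 1 := ⟨_, by rw [mul_comm]; exact h1⟩
    exact Int.eq_one_of_dvd_one h2 this
  rw [hall f hf, h3, mul_one]

theorem Crv.B_R [IsAlgClosed K] (C : Crv K p a q t e x y z) (I : Inf K q t x y z v) {σ : F ≃ₐ[K] F}
    (hσ : Bset K v σ) {f : F} (hf : f ∈ Rg K x y z) : σ f ∈ Rg K x y z := by
  apply C.mem_of_V
  intro V hK hR
  rcases C.dich I V hK σ with h | h
  · exact h f hf
  · exfalso
    apply C.x_not I
    rw [← σ.apply_symm_apply x, hσ, ← h, σ.apply_symm_apply]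
    exact hR x x_mem

theorem Crv.B_G (C : Crv K p a q t e x y z) (I : Inf K q t x y z v) {σ : F ≃ₐ[K] F}
    (hσ : Bset K v σ) {n : ℤ} {f : F} (hf : E v n f) : E v n (σ f) :=
  ⟨by simpa using hf.1, by rw [C.B_v I hσ hf.1, hf.2]⟩

end
end YC1


namespace YC1

section
variable {K F : Type} [Field K] [Field F] [Algebra K F] {p a q t e : ℕ} {x y z : F} {v : F → ℤ}

theorem Crv.teq (C : Crv K p a q t e x y z) : t * e * (q + 1) = q ^ 3 + 1 := by
  have h := C.hte
  have : t * e * (q + 1) + q * (q + 1) = (q ^ 2 + 1) * (q + 1) := by rw [← h]; ring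
  nlinarith

theorem Crv.tq3 (C : Crv K p a q t e x y z) : t * (q + 1) ≤ q ^ 3 + 1 := by
  have h := C.teq
  have h1 := C.e1
  calc t * (q + 1) = t * 1 * (q + 1) := by ring
    _ ≤ t * e * (q + 1) := by gcongr
    _ = _ := h

theorem Crv.NMy (C : Crv K p a q t e x y z) {f : F} (hf : f ∈ NM K q t x y z (q * t + 1)) :
    ∃ α β : K, f = algebraMap K F α * y + algebraMap K F β := by
  have hq := C.q2
  have ht := C.ht
  have htq := C.tq3
  refine Submodule.span_induction ?_ ?_ ?_ ?_ hf
  · rintro _ ⟨i, j, k, hj, hk, hd, rfl⟩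
    unfold dg at hd
    have e0 : (q + 1) * t = q * t + t := by ring
    have e0' : t * (q + 1) = q * t + t := by ring
    rw [e0] at hd
    rw [e0'] at htq
    have hi : i = 0 := by
      by_contra h
      have : 1 * (q * t + t) ≤ i * (q * t + t) := Nat.mul_le_mul_right _ (by omega)
      omega
    have hk0 : k = 0 := by
      by_contra h
      have : 1 * q ^ 3 ≤ k * q ^ 3 := Nat.mul_le_mul_right _ (by omega)
      omega
    have hj1 : j ≤ 1 := by
      by_contra h
      have : 2 * (q * t) ≤ j * (q * t) := Nat.mul_le_mul_right _ (by omega)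
      have : 0 < q * t := by positivity
      nlinarith
    subst hi; subst hk0
    interval_cases j
    · exact ⟨0, 1, by simp⟩
    · exact ⟨1, 0, by simp⟩
  · exact ⟨0, 0, by simp⟩
  · rintro f g _ _ ⟨a1, b1, rfl⟩ ⟨a2, b2, rfl⟩
    exact ⟨a1 + a2, b1 + b2, by simp only [map_add]; ring⟩
  · rintro c f _ ⟨a1, b1, rfl⟩
    exact ⟨c * a1, c * b1, by simp only [map_mul, Algebra.smul_def]; ring⟩

theorem Crv.NMx (C : Crv K p a q t e x y z) {f : F} (hf : f ∈ NM K q t x y z ((q + 1) * t + 1)) :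
    ∃ γ δ ε ζ : K, f = algebraMap K F γ * x + algebraMap K F δ * y + algebraMap K F ε +
      algebraMap K F ζ * z := by
  have hq := C.q2
  have ht := C.ht
  have htq := C.tq3
  have hqt : 2 * t ≤ q * t := Nat.mul_le_mul_right _ hq
  have hq3 : 2 * 2 * 2 ≤ q ^ 3 := by
    calc 2 * 2 * 2 = 2 ^ 3 := by norm_num
      _ ≤ q ^ 3 := Nat.pow_le_pow_left hq 3
  refine Submodule.span_induction ?_ ?_ ?_ ?_ hf
  · rintro _ ⟨i, j, k, hj, hk, hd, rfl⟩
    unfold dg at hd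
    have e0 : (q + 1) * t = q * t + t := by ring
    have e0' : t * (q + 1) = q * t + t := by ring
    rw [e0] at hd
    rw [e0'] at htq
    have hi1 : i ≤ 1 := by
      by_contra h
      have : 2 * (q * t + t) ≤ i * (q * t + t) := Nat.mul_le_mul_right _ (by omega)
      omega
    have hk0 : k ≤ 1 := by
      by_contra h
      have : 2 * q ^ 3 ≤ k * q ^ 3 := Nat.mul_le_mul_right _ (by omega)
      omega
    have hj1 : j ≤ 1 := by
      by_contra h
      have : 2 * (q * t) ≤ j * (q * t) := Nat.mul_le_mul_right _ (by omega)
      omega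
    interval_cases i <;> interval_cases j <;> interval_cases k <;> simp only [zero_mul, one_mul] at hd <;>
      first
      | omega
      | (refine ⟨1, 0, 0, 0, ?_⟩; simp; done)
      | (refine ⟨0, 1, 0, 0, ?_⟩; simp; done)
      | (refine ⟨0, 0, 1, 0, ?_⟩; simp; done)
      | (refine ⟨0, 0, 0, 1, ?_⟩; simp; done)
  · exact ⟨0, 0, 0, 0, by simp⟩
  · rintro f g _ _ ⟨a1, b1, c1, d1, rfl⟩ ⟨a2, b2, c2, d2, rfl⟩
    exact ⟨a1 + a2, b1 + b2, c1 + c2, d1 + d2, by simp only [map_add]; ring⟩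
  · rintro c f _ ⟨a1, b1, c1, d1, rfl⟩
    exact ⟨c * a1, c * b1, c * c1, c * d1, by simp only [map_mul, Algebra.smul_def]; ring⟩

theorem Crv.indep7 (C : Crv K p a q t e x y z) (I : Inf K q t x y z v) (c1 c2 c3 c4 c5 c6 c7 : K)
    (h : algebraMap K F c1 * 1 + algebraMap K F c2 * y + algebraMap K F c3 * x + algebraMap K F c4 * y ^ q +
      algebraMap K F c5 * x ^ q + algebraMap K F c6 * z + algebraMap K F c7 * z ^ q = 0) :
    c1 = 0 ∧ c2 = 0 ∧ c3 = 0 ∧ c4 = 0 ∧ c5 = 0 ∧ c6 = 0 ∧ c7 = 0 := by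
  have hq := C.q2
  have ht := C.ht
  have hO := I.ov
  have Ex := C.Ex I
  have Ey := C.Ey I
  have Ez := C.Ez I
  have nd : ∀ k : ℕ, ¬ (t : ℤ) ∣ (q : ℤ) ^ k := by
    intro k h
    have h1 : t ∣ q ^ k := by exact_mod_cast h
    have := Nat.Coprime.eq_one_of_dvd (C.cop.pow_right k) h1
    omega
  have hx1 : ∀ A k : ℕ, ((A * t : ℕ) : ℤ) ≠ (q : ℤ) ^ k := fun A k h => nd k ⟨A, by rw [← h]; push_cast; ring⟩
  have E1 : E v 0 (1 : F) := hO.E_one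
  have E4 := hO.E_pow Ey q
  have E5 := hO.E_pow Ex q
  have E7 := hO.E_pow Ez q
  have n12 := hx1 0 3
  have n13 := hx1 0 4
  have n22 := hx1 q 3
  have n23 := hx1 q 4
  have n32 := hx1 (q + 1) 3
  have n33 := hx1 (q + 1) 4
  have n42 := hx1 (q * q) 3
  have n43 := hx1 (q * q) 4
  have n52 := hx1 (q * (q + 1)) 3
  have n53 := hx1 (q * (q + 1)) 4
  have l1 : (0 : ℤ) < q * t := by positivity
  have l2 : (q * t : ℤ) < (q + 1) * t := by nlinarith
  have l3 : ((q + 1) * t : ℤ) < q * (q * t) := by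
    have : (q + 1 : ℤ) < q * q := by nlinarith
    nlinarith
  have l4 : (q * (q * t) : ℤ) < q * ((q + 1) * t) := by nlinarith
  have l5 : (q ^ 3 : ℤ) < q * q ^ 3 := by
    have : (0 : ℤ) < q ^ 3 := by positivity
    nlinarith
  have e7 : (q : ℤ) ^ 4 = q * q ^ 3 := by ring
  push_cast at n12 n13 n22 n23 n32 n33 n42 n43 n52 n53
  rw [show (q * q * t : ℤ) = q * (q * t) by ring] at n42 n43
  rw [show (q * (q + 1) * t : ℤ) = q * ((q + 1) * t) by ring] at n52 n53
  rw [e7] at n13 n23 n33 n43 n53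
  rw [mul_neg] at E4 E5 E7
  rw [zero_mul] at n12 n13
  generalize (q * t : ℤ) = A1 at *
  generalize ((q + 1) * t : ℤ) = A2 at *
  generalize (q * A1 : ℤ) = A3 at *
  generalize (q * A2 : ℤ) = A4 at *
  generalize (q * q ^ 3 : ℤ) = B2 at *
  generalize (q ^ 3 : ℤ) = B1 at *
  have key := hO.indep (ι := Fin 7) ![c1, c2, c3, c4, c5, c6, c7] ![1, y, x, y ^ q, x ^ q, z, z ^ q]
    ![0, -A1, -A2, -A3, -A4, -B1, -B2] ?_ ?_ ?_
  · exact ⟨key 0, key 1, key 2, key 3, key 4, key 5, key 6⟩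
  · intro i
    fin_cases i <;> simp <;> assumption
  · intro i j
    fin_cases i <;> fin_cases j <;> simp <;> omega
  · simp [Fin.sum_univ_succ]
    rw [← h]; ring

/-- the structure of automorphisms fixing infinity -/
theorem Crv.B_form [IsAlgClosed K] (C : Crv K p a q t e x y z) (I : Inf K q t x y z v) {σ : F ≃ₐ[K] F}
    (hσ : Bset K v σ) : ∃ l β ε : K, l ^ (t * (q ^ 2 - 1)) = 1 ∧ β ^ (q ^ 2) = β ∧ ε ^ q + ε = β ^ (q + 1) ∧
      σ x = algebraMap K F ((l ^ t) ^ (q + 1)) * x + algebraMap K F (l ^ t * β ^ q) * y + algebraMap K F ε ∧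
      σ y = algebraMap K F (l ^ t) * y + algebraMap K F β ∧
      σ z = algebraMap K F l * z := by
  have hq := C.q2
  have ht := C.ht
  have hO := I.ov
  have hy := C.mem_NM_of I (C.B_R I hσ y_mem) (D := q * t) (by push_cast; exact (C.B_G I hσ (C.Ey I)).toG)
  have hx := C.mem_NM_of I (C.B_R I hσ x_mem) (D := (q + 1) * t)
    (by push_cast; exact (C.B_G I hσ (C.Ex I)).toG)
  obtain ⟨α, β, hy⟩ := C.NMy hy
  obtain ⟨γ, δ, ε, ζ, hx⟩ := C.NMx hx
  have h2 : (σ y) ^ (q + 1) = (σ x) ^ q + σ x := by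
    rw [← map_pow, C.r2, map_add, map_pow]
  have hα : α ≠ 0 := by
    rintro rfl
    have h3 : σ y = algebraMap K F β := by rw [hy]; simp
    have h4 := hO.G_const (F := F) β
    rw [← h3, hσ] at h4
    have h5 := (C.Ey I).not_G h4
    have : (0 : ℤ) < q * t := by positivity
    omega
  have fr : ∀ f g : F, (f + g) ^ q = f ^ q + g ^ q := fun f g => by simpa using C.frobF 1 f g
  rw [hy, hx, pow_succ, fr, fr, fr, fr] at h2
  have r2 := C.r2
  rw [pow_succ] at r2
  obtain ⟨k1, k2, k3, k4, k5, k6, -⟩ := C.indep7 I (ε ^ q + ε - β ^ (q + 1)) (δ - α * β ^ q) (γ - α ^ (q + 1))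
    (δ ^ q - α ^ q * β) (γ ^ q - α ^ (q + 1)) ζ (ζ ^ q) (by
      simp only [map_sub, map_add, map_mul, map_pow]
      simp only [mul_pow] at h2
      linear_combination -h2 + (algebraMap K F α) ^ (q + 1) * r2)
  rw [sub_eq_zero] at k1 k2 k3 k4 k5
  have hβ : β ^ (q ^ 2) = β := by
    rw [k2, mul_pow, ← pow_mul, ← pow_two] at k4
    exact mul_left_cancel₀ (pow_ne_zero _ hα) k4
  have hα1 : α ^ (q ^ 2) = α := by
    rw [k3, ← pow_mul] at k5
    have h3 : α ^ q * α ^ (q ^ 2) = α ^ q * α := by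
      rw [← pow_add, ← pow_succ, ← k5]; congr 1; ring
    exact mul_left_cancel₀ (pow_ne_zero _ hα) h3
  have h1 : (σ z) ^ t = algebraMap K F α * z ^ t := by
    rw [← map_pow, C.r1, map_sub, map_pow, hy, C.frobF, mul_pow, ← map_pow, ← map_pow, hα1, hβ]
    ring
  have hz0 := (C.Ez I).1
  obtain ⟨l, hl⟩ := in_K (K := K) (f := σ z / z) (n := t) (by omega) (c := α) (by
    rw [div_pow, h1, mul_div_assoc, div_self (pow_ne_zero _ hz0), mul_one])
  have hlt : l ^ t = α := by
    apply (algebraMap K F).injective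
    rw [map_pow, ← hl, div_pow, h1, mul_div_assoc, div_self (pow_ne_zero _ hz0), mul_one]
  refine ⟨l, β, ε, ?_, hβ, k1, ?_, ?_, ?_⟩
  · rw [pow_mul, hlt]
    have h3 : α ^ (q ^ 2 - 1) * α = 1 * α := by
      rw [← pow_succ, one_mul]
      have : 0 < q ^ 2 := by positivity
      rw [Nat.sub_add_cancel this, hα1]
    exact mul_right_cancel₀ hα h3
  · rw [hlt, hx, k6, k3, k2]; simp
  · rw [hlt, hy]
  · rw [← hl, div_mul_cancel₀ _ hz0]

end
end YC1


namespace YC1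

section
variable {K F : Type} [Field K] [Field F] [Algebra K F] {p a q t e : ℕ} {x y z : F} {v : F → ℤ}

theorem Crv.B_of [IsAlgClosed K] (C : Crv K p a q t e x y z) (I : Inf K q t x y z v) {σ : F ≃ₐ[K] F}
    (h : ¬ G v 0 (σ x)) : Bset K v σ := by
  obtain ⟨V, hK, hV⟩ := C.Vinf I
  rcases C.dich I V hK σ with h1 | h1
  · exact absurd ((hV _).1 (h1 x x_mem)) h
  · intro f; rw [← hV, h1]

theorem Crv.integral_x (C : Crv K p a q t e x y z) (f : Rg K x y z) :
    IsIntegral (Algebra.adjoin K {(⟨x, x_mem⟩ : Rg K x y z)}) f := by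
  have ht := C.ht
  let A := Algebra.adjoin K {(⟨x, x_mem⟩ : Rg K x y z)}
  have hX : IsIntegral A (⟨x, x_mem⟩ : Rg K x y z) := by
    exact (isIntegral_algebraMap (R := A) (x := ⟨_, Algebra.subset_adjoin (Set.mem_singleton _)⟩) : IsIntegral A (algebraMap A (Rg K x y z) _))
  have hY : IsIntegral A (⟨y, y_mem⟩ : Rg K x y z) := by
    refine IsIntegral.of_pow (n := q + 1) (by omega) ?_
    have : (⟨y, y_mem⟩ : Rg K x y z) ^ (q + 1) = ⟨x, x_mem⟩ ^ q + ⟨x, x_mem⟩ := by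
      apply Subtype.ext; simpa using C.r2
    rw [this]
    exact (hX.pow q).add hX
  have hZ : IsIntegral A (⟨z, z_mem⟩ : Rg K x y z) := by
    refine IsIntegral.of_pow (n := t) (by omega) ?_
    have : (⟨z, z_mem⟩ : Rg K x y z) ^ t = ⟨y, y_mem⟩ ^ (q ^ 2) - ⟨y, y_mem⟩ := by
      apply Subtype.ext; simpa using C.r1
    rw [this]
    exact (hY.pow _).sub hY
  obtain ⟨f, hf⟩ := f
  refine Algebra.adjoin_induction (p := fun f hf => IsIntegral A (⟨f, hf⟩ : Rg K x y z)) ?_ ?_ ?_ ?_ hf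
  · intro f hf
    simp only [Set.mem_insert_iff, Set.mem_singleton_iff] at hf
    rcases hf with rfl | rfl | rfl
    · exact hX
    · exact hY
    · exact hZ
  · intro c
    have : (⟨algebraMap K F c, c_mem c⟩ : Rg K x y z) = algebraMap A _ (algebraMap K A c) := rfl
    exact this ▸ isIntegral_algebraMap
  · intro f g hf hg h1 h2
    exact h1.add h2
  · intro f g hf hg h1 h2
    exact h1.mul h2

theorem Crv.exists_hom [IsAlgClosed K] (C : Crv K p a q t e x y z) {x' y' z' : F}
    (h1 : z' ^ t = y' ^ (q ^ 2) - y') (h2 : y' ^ (q + 1) = x' ^ q + x')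
    (hx : ∀ c : K, x' ≠ algebraMap K F c) :
    ∃ Φ : F →ₐ[K] F, Φ x = x' ∧ Φ y = y' ∧ Φ z = z' := by
  obtain ⟨φ, e1, e2, e3⟩ := C.lift x' y' z' h1 h2
  have hinj : Function.Injective φ := by
    rw [injective_iff_map_eq_zero]
    intro f hf
    by_contra h0
    have hne := Ideal.comap_ne_bot_of_integral_mem (I := RingHom.ker φ) h0 hf (C.integral_x f)
    apply hne
    rw [eq_bot_iff]
    rintro ⟨g, hg⟩ hg'
    have hg1 : φ g = 0 := hg'
    rw [Algebra.adjoin_singleton_eq_range_aeval] at hg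
    obtain ⟨P, rfl⟩ := hg
    have hP : P = 0 := by
      by_contra hP
      have h4 : IsAlgebraic K x' := ⟨P, hP, by
        rw [← e1, Polynomial.aeval_algHom_apply]; exact hg1⟩
      have h5 := IsAlgClosed.degree_eq_one_of_irreducible K (minpoly.irreducible h4.isIntegral)
      obtain ⟨c, hc⟩ := minpoly.mem_range_of_degree_eq_one K x' h5
      exact hx c hc.symm
    rw [Ideal.mem_bot]
    apply Subtype.ext
    simp [hP]
  have := C.isFrac
  refine ⟨IsFractionRing.liftAlgHom (K := F) hinj, ?_, ?_, ?_⟩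
  · rw [← e1]; exact IsFractionRing.lift_algebraMap (K := F) (g := (φ : Rg K x y z →+* F)) hinj ⟨x, x_mem⟩
  · rw [← e2]; exact IsFractionRing.lift_algebraMap (K := F) (g := (φ : Rg K x y z →+* F)) hinj ⟨y, y_mem⟩
  · rw [← e3]; exact IsFractionRing.lift_algebraMap (K := F) (g := (φ : Rg K x y z →+* F)) hinj ⟨z, z_mem⟩

theorem Crv.bij_hom (C : Crv K p a q t e x y z) (Φ : F →ₐ[K] F)
    (hx : x ∈ Φ.range) (hy : y ∈ Φ.range) (hz : z ∈ Φ.range) : Function.Bijective Φ := by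
  refine ⟨Φ.toRingHom.injective, ?_⟩
  have hle : Rg K x y z ≤ Φ.range := by
    apply Algebra.adjoin_le
    rintro f (rfl | rfl | rfl) <;> assumption
  intro f
  obtain ⟨r, hr, s, hs, _, rfl⟩ := C.frac f
  obtain ⟨r', h1⟩ := hle hr
  obtain ⟨s', h2⟩ := hle hs
  exact ⟨r' / s', by rw [map_div₀]; exact congrArg₂ _ h1 h2⟩

theorem Crv.aut_ext (C : Crv K p a q t e x y z) {σ τ : F ≃ₐ[K] F} (hx : σ x = τ x) (hy : σ y = τ y)
    (hz : σ z = τ z) : σ = τ := by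
  have hR : ∀ f ∈ Rg K x y z, σ f = τ f := by
    intro f hf
    refine Algebra.adjoin_induction (p := fun f _ => σ f = τ f) ?_ ?_ ?_ ?_ hf
    · rintro f (rfl | rfl | rfl) <;> assumption
    · intro c; simp
    · intro f g _ _ h1 h2; simp [h1, h2]
    · intro f g _ _ h1 h2; simp [h1, h2]
  apply AlgEquiv.ext
  intro f
  obtain ⟨r, hr, s, hs, _, rfl⟩ := C.frac f
  rw [map_div₀, map_div₀, hR r hr, hR s hs]

/-- parameters for the automorphisms fixing infinity -/
def Par (q t : ℕ) (l β ε : K) : Prop :=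
  l ^ (t * (q ^ 2 - 1)) = 1 ∧ β ^ (q ^ 2) = β ∧ ε ^ q + ε = β ^ (q + 1)

/-- explicit shape of the automorphisms fixing infinity -/
def Shp (q t : ℕ) (x y z : F) (σ : F ≃ₐ[K] F) (l β ε : K) : Prop :=
  σ x = algebraMap K F ((l ^ t) ^ (q + 1)) * x + algebraMap K F (l ^ t * β ^ q) * y + algebraMap K F ε ∧
      σ y = algebraMap K F (l ^ t) * y + algebraMap K F β ∧
      σ z = algebraMap K F l * z

theorem Crv.shp_E (C : Crv K p a q t e x y z) (I : Inf K q t x y z v) (l β ε : K) (hl : l ≠ 0) :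
    E v (-((q + 1) * t : ℤ)) (algebraMap K F ((l ^ t) ^ (q + 1)) * x + algebraMap K F (l ^ t * β ^ q) * y +
      algebraMap K F ε) := by
  have hO := I.ov
  have hq := C.q2
  have ht := C.ht
  have h1 : E v (-((q + 1) * t : ℤ)) (algebraMap K F ((l ^ t) ^ (q + 1)) * x) := by
    simpa using hO.E_mul (hO.E_const (F := F) (pow_ne_zero (q + 1) (pow_ne_zero t hl))) (C.Ex I)
  have h2 : G v (-((q + 1) * t : ℤ) + 1) (algebraMap K F (l ^ t * β ^ q) * y) := by
    have := hO.G_mul (hO.G_const (F := F) (l ^ t * β ^ q)) (C.Ey I).toG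
    refine this.mono ?_
    have : ((q + 1) * t : ℤ) = q * t + t := by ring
    omega
  have h3 : G v (-((q + 1) * t : ℤ) + 1) (algebraMap K F ε) := by
    refine (hO.G_const (F := F) ε).mono ?_
    have : (0 : ℤ) < ((q + 1) * t : ℤ) := by positivity
    omega
  exact hO.E_add (hO.E_add h1 h2) h3

theorem Crv.par_ne (C : Crv K p a q t e x y z) {l β ε : K} (h : Par q t l β ε) : l ≠ 0 := by
  rintro rfl
  have hq := C.q2
  have ht := C.ht
  have h1 := h.1
  have : 2 ^ 2 ≤ q ^ 2 := Nat.pow_le_pow_left hq 2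
  rw [zero_pow] at h1
  · exact zero_ne_one h1
  · have : 0 < q ^ 2 - 1 := by omega
    positivity

theorem Crv.par_al (C : Crv K p a q t e x y z) {l β ε : K} (h : Par q t l β ε) : (l ^ t) ^ (q ^ 2) = l ^ t := by
  have hq := C.q2
  have h1 := h.1
  have : 2 ^ 2 ≤ q ^ 2 := Nat.pow_le_pow_left hq 2
  rw [pow_mul] at h1
  calc (l ^ t) ^ (q ^ 2) = (l ^ t) ^ (q ^ 2 - 1) * l ^ t := by
        rw [← pow_succ]; congr 1; omega
    _ = _ := by rw [h1, one_mul]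

theorem Crv.exists_shp [IsAlgClosed K] (C : Crv K p a q t e x y z) (I : Inf K q t x y z v) {l β ε : K}
    (h : Par q t l β ε) : ∃ σ : F ≃ₐ[K] F, Shp q t x y z σ l β ε := by
  have hl := C.par_ne h
  have hq := C.q2
  have ht := C.ht
  have hal := C.par_al h
  obtain ⟨h1, h2, h3⟩ := h
  have hE := C.shp_E I l β ε hl
  have hl' : algebraMap K F l ≠ 0 := by simpa using hl
  obtain ⟨Φ, e1, e2, e3⟩ := C.exists_hom
    (x' := algebraMap K F ((l ^ t) ^ (q + 1)) * x + algebraMap K F (l ^ t * β ^ q) * y + algebraMap K F ε)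
    (y' := algebraMap K F (l ^ t) * y + algebraMap K F β) (z' := algebraMap K F l * z) (by
      rw [mul_pow, C.r1, C.frobF, mul_pow, ← map_pow, ← map_pow, ← map_pow, hal, h2]; ring) (by
      have fr : ∀ f g : F, (f + g) ^ q = f ^ q + g ^ q := fun f g => by simpa using C.frobF 1 f g
      have r2 := C.r2
      have h3' : (algebraMap K F ε) ^ q + algebraMap K F ε = algebraMap K F β ^ (q + 1) := by
        rw [← map_pow, ← map_pow, ← h3, map_add]
      have hal' : ((algebraMap K F l ^ t) ^ q) ^ q = algebraMap K F l ^ t := by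
        rw [← pow_mul, ← pow_two, ← map_pow, ← map_pow, hal]
      have hβ' : ((algebraMap K F β) ^ q) ^ q = algebraMap K F β := by
        rw [← pow_mul, ← pow_two, ← map_pow, h2]
      simp only [map_mul, map_pow]
      rw [pow_succ, fr, fr, fr]
      simp only [mul_pow]
      rw [hβ']
      generalize algebraMap K F l ^ t = A at *
      have hA : (A ^ (q + 1)) ^ q = A ^ (q + 1) := by
        rw [← pow_mul, mul_comm, pow_mul, pow_succ, hal', pow_succ, mul_comm]
      rw [hA]
      linear_combination A ^ (q + 1) * r2 - h3') (by
      intro c hc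
      rw [hc] at hE
      have h4 := hE.not_G (I.ov.G_const c)
      have : (0 : ℤ) < (q + 1) * t := by positivity
      omega)
  have hc : ∀ c : K, algebraMap K F c ∈ Φ.range := fun c => Subalgebra.algebraMap_mem _ c
  have hr : ∀ f, Φ f ∈ Φ.range := fun f => ⟨f, rfl⟩
  have hlt : algebraMap K F (l ^ t) ≠ 0 := by rw [map_pow]; exact pow_ne_zero _ hl'
  have hlq : algebraMap K F ((l ^ t) ^ (q + 1)) ≠ 0 := by rw [map_pow, map_pow]; exact pow_ne_zero _ (pow_ne_zero _ hl')
  have hy : y ∈ Φ.range := by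
    have : y = algebraMap K F (l ^ t)⁻¹ * (Φ y - algebraMap K F β) := by
      rw [e2, map_inv₀]; field_simp; ring
    rw [this]; exact mul_mem (hc _) (sub_mem (hr _) (hc _))
  have hz : z ∈ Φ.range := by
    have : z = algebraMap K F (l)⁻¹ * Φ z := by
      rw [e3, map_inv₀]; field_simp
    rw [this]; exact mul_mem (hc _) (hr _)
  have hx : x ∈ Φ.range := by
    have : x = algebraMap K F ((l ^ t) ^ (q + 1))⁻¹ * (Φ x - algebraMap K F (l ^ t * β ^ q) * y - algebraMap K F ε) := by
      rw [e1, map_inv₀, eq_inv_mul_iff_mul_eq₀ hlq]; ring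
    rw [this]; exact mul_mem (hc _) (sub_mem (sub_mem (hr _) (mul_mem (hc _) hy)) (hc _))
  exact ⟨AlgEquiv.ofBijective Φ (C.bij_hom Φ hx hy hz), e1, e2, e3⟩

theorem Crv.shp_B [IsAlgClosed K] (C : Crv K p a q t e x y z) (I : Inf K q t x y z v) {l β ε : K} (hl : l ≠ 0)
    {σ : F ≃ₐ[K] F} (hσ : Shp q t x y z σ l β ε) : Bset K v σ := by
  apply C.B_of I
  rw [hσ.1]
  intro h
  have h1 := (C.shp_E I l β ε hl).not_G h
  have hq := C.q2
  have ht := C.ht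
  have : (0 : ℤ) < (q + 1) * t := by positivity
  omega

theorem Crv.shp_inj (C : Crv K p a q t e x y z) (I : Inf K q t x y z v) {l β ε l' β' ε' : K} {σ : F ≃ₐ[K] F}
    (h : Shp q t x y z σ l β ε) (h' : Shp q t x y z σ l' β' ε') : l = l' ∧ β = β' ∧ ε = ε' := by
  obtain ⟨h1, h2, h3⟩ := h
  obtain ⟨h1', h2', h3'⟩ := h'
  have hz0 := (C.Ez I).1
  have e1 : l = l' := by
    apply (algebraMap K F).injective
    apply mul_right_cancel₀ hz0
    rw [← h3, h3']
  subst e1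
  have e2 : β = β' := by
    apply (algebraMap K F).injective
    exact add_left_cancel (h2.symm.trans h2')
  subst e2
  refine ⟨rfl, rfl, ?_⟩
  apply (algebraMap K F).injective
  exact add_left_cancel (h1.symm.trans h1')

theorem Crv.t_odd (C : Crv K p a q t e x y z) : Odd t := by
  have h := C.hte
  have h1 : Odd (t * e) := by
    have : t * e = q * (q - 1) + 1 := by
      have hq := C.q2
      obtain ⟨r, rfl⟩ : ∃ r, q = r + 1 := ⟨q - 1, by omega⟩
      simp only [Nat.add_sub_cancel]
      nlinarith
    rw [this]
    exact (Nat.even_mul_pred_self q).add_one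
  exact (Nat.odd_mul.1 h1).1

/-- the involution exchanging infinity with the origin -/
theorem Crv.exists_w [IsAlgClosed K] (C : Crv K p a q t e x y z) (I : Inf K q t x y z v) :
    ∃ w : F ≃ₐ[K] F, w x = x⁻¹ ∧ w y = y / x ∧ w z = - z / x ^ e := by
  have hx0 := (C.Ex I).1
  have hq := C.q2
  have ht := C.ht
  have r1 := C.r1
  have r2 := C.r2
  have hte := C.hte
  obtain ⟨Φ, e1, e2, e3⟩ := C.exists_hom (x' := x⁻¹) (y' := y / x) (z' := - z / x ^ e) (by
      rw [div_pow, C.t_odd.neg_pow, r1, div_pow, ← pow_mul, mul_comm e t]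
      have fr : (y ^ (q + 1)) ^ q = x ^ (q ^ 2) + x ^ q := by
        rw [r2]
        have := C.frobF 1 (x ^ q) x
        rw [pow_one] at this
        rw [this, ← pow_mul, ← pow_two]
      have k1 : y ^ (q ^ 2) * y ^ (q + 1) = (x ^ (q ^ 2) + x ^ q) * y := by
        rw [← fr]; ring
      have k2 : x ^ (q ^ 2) = x ^ (q ^ 2 - 1) * x := by
        rw [← pow_succ]; congr 1
        have : 0 < q ^ 2 := by positivity
        omega
      have k3 : y ^ (q ^ 2) * x - y * x ^ (q ^ 2) = - (y ^ (q ^ 2) - y) * x ^ q := by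
        rw [r2] at k1
        linear_combination k1
      have k4 : x ^ (t * e) * x ^ q = x ^ (q ^ 2) * x := by
        rw [← pow_add, hte, pow_succ]
      have hxe : x ^ (t * e) ≠ 0 := pow_ne_zero _ hx0
      have hxq2 : x ^ (q ^ 2) ≠ 0 := pow_ne_zero _ hx0
      have hxq : x ^ q ≠ 0 := pow_ne_zero _ hx0
      rw [div_sub_div _ _ hxq2 hx0, div_eq_div_iff hxe (mul_ne_zero hxq2 hx0), ← k4]
      rw [mul_comm (x ^ (q ^ 2)) y, k3]
      ring) (by
      rw [div_pow, r2, pow_succ]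
      have hxq : x ^ q ≠ 0 := pow_ne_zero _ hx0
      rw [inv_pow]
      field_simp
      ring) (by
      intro c hc
      apply C.x_trans c⁻¹
      rw [map_inv₀, ← hc, inv_inv])
  have hx : Φ x⁻¹ = x := by rw [map_inv₀, e1, inv_inv]
  have hy : Φ (y / x) = y := by rw [map_div₀, e1, e2]; field_simp
  have hz : Φ (- z / x ^ e) = z := by
    rw [map_div₀, map_neg, map_pow, e1, e3, inv_pow]
    have hxe : x ^ e ≠ 0 := pow_ne_zero _ hx0
    field_simp
  exact ⟨AlgEquiv.ofBijective Φ (C.bij_hom Φ ⟨_, hx⟩ ⟨_, hy⟩ ⟨_, hz⟩), e1, e2, e3⟩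

end
end YC1


namespace YC1

section
variable {K F : Type} [Field K] [Field F] [Algebra K F] {p a q t e : ℕ} {x y z : F} {v v' : F → ℤ}

/-- regular at all affine places different from the place of `v'` -/
def Mreg (K : Type) {F : Type} [Field K] [Field F] [Algebra K F] (v' : F → ℤ) (x y z : F) (h : F) : Prop :=
  ∀ V : ValuationSubring F, (∀ c : K, algebraMap K F c ∈ V) → (∀ f ∈ Rg K x y z, f ∈ V) →
    ¬ (∀ f, f ∈ V ↔ G v' 0 f) → h ∈ V

theorem Mreg_R {f : F} (hf : f ∈ Rg K x y z) : Mreg K v' x y z f := fun _ _ hR _ => hR f hf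

theorem Mreg.mul {f g : F} (hf : Mreg K v' x y z f) (hg : Mreg K v' x y z g) : Mreg K v' x y z (f * g) :=
  fun V h1 h2 h3 => mul_mem (hf V h1 h2 h3) (hg V h1 h2 h3)

theorem Mreg.sub {f g : F} (hf : Mreg K v' x y z f) (hg : Mreg K v' x y z g) : Mreg K v' x y z (f - g) :=
  fun V h1 h2 h3 => sub_mem (hf V h1 h2 h3) (hg V h1 h2 h3)

theorem Crv.Mreg_symm (C : Crv K p a q t e x y z) (I : Inf K q t x y z v) (σ : F ≃ₐ[K] F) {r : F}
    (hr : r ∈ Rg K x y z) : Mreg K (fun f => v (σ f)) x y z (σ.symm r) := by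
  intro V hK _ hV
  rcases C.dich I V hK σ.symm with h | h
  · exact h r hr
  · exfalso; apply hV
    intro f
    rw [G_comp, ← h, AlgEquiv.symm_apply_apply]

theorem Crv.Mreg_mem [IsAlgClosed K] (C : Crv K p a q t e x y z) {h : F} (hM : Mreg K v' x y z h)
    (h0 : G v' 0 h) : h ∈ Rg K x y z := by
  refine C.mem_of_V (fun V hK hR => ?_)
  by_cases hV : ∀ f, f ∈ V ↔ G v' 0 f
  · exact (hV h).2 h0
  · exact hM V hK hR hV

theorem Crv.rep (C : Crv K p a q t e x y z) (N : ℤ) : ∃ (i : ℤ) (j k : ℕ), j ≤ q ∧ k < t ∧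
    N = i * ((q + 1) * t) + j * (q * t) + k * q ^ 3 := by
  have ht := C.ht
  have hq := C.q2
  have hc : IsCoprime (t : ℤ) (q ^ 3 : ℤ) := by
    have := (C.cop.pow_right 3)
    exact_mod_cast (Nat.isCoprime_iff_coprime.2 this)
  obtain ⟨α, β, hαβ⟩ := hc
  have htz : (0 : ℤ) < t := by positivity
  obtain ⟨k, hk⟩ := Int.eq_ofNat_of_zero_le (Int.emod_nonneg (N * β) htz.ne')
  have hk' : k < t := by
    have := Int.emod_lt_of_pos (N * β) htz
    omega
  have hk2 := Int.emod_add_mul_ediv (N * β) t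
  set Q := N * β / t
  -- N = N α t + N β q^3 = N α t + (k + t Q) q^3
  have hM : N = k * q ^ 3 + t * (N * α + Q * q ^ 3) := by
    linear_combination (-N) * hαβ - q ^ 3 * hk2 + q ^ 3 * hk
  set M := N * α + Q * q ^ 3 with hMdef
  have hqz : (0 : ℤ) < (q : ℤ) + 1 := by positivity
  obtain ⟨j, hj⟩ := Int.eq_ofNat_of_zero_le (Int.emod_nonneg (-M) hqz.ne')
  have hj' : j ≤ q := by
    have := Int.emod_lt_of_pos (-M) hqz
    omega
  have hj2 := Int.emod_add_mul_ediv (-M) ((q : ℤ) + 1)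
  set S := -M / ((q : ℤ) + 1)
  refine ⟨-S - j, j, k, hj', hk', ?_⟩
  rw [hM]
  have : M = (-S - j) * (q + 1) + j * q := by
    linear_combination hj2 - hj
  linear_combination t * this

theorem Crv.gap [IsAlgClosed K] (C : Crv K p a q t e x y z) (I : Inf K q t x y z v) (hO : OV K v')
    (hR : ∀ f ∈ Rg K x y z, G v' 0 f) {D : ℕ} (hD : D + (q + 1) * t = q ^ 2 * t + (t - 1) * q ^ 3) (n : ℕ) :
    ∀ h : F, n ≤ D → Mreg K v' x y z h → E v' (-1) h → - v h < n → False := by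
  have ht := C.ht
  have hq := C.q2
  have hv := I.ov
  have hDz : (D : ℤ) + (q + 1) * t = q ^ 2 * t + (t - 1) * q ^ 3 := by
    have : ((t - 1 : ℕ) : ℤ) = t - 1 := by omega
    rw [← this]; exact_mod_cast hD
  -- the general step
  have key : ∀ h : F, Mreg K v' x y z h → E v' (-1) h → - v h < D → ∀ (i : ℤ) (j k : ℕ), j ≤ q → k < t →
      - v h = i * ((q + 1) * t) + j * (q * t) + k * q ^ 3 → i < 0 → False := by
    intro h hM hE hlt i j k hj hk hrep hi
    obtain ⟨i', hi'⟩ : ∃ i' : ℕ, (i' : ℤ) = -1 - i := ⟨(-1 - i).toNat, by omega⟩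
    set r := x ^ i' * y ^ (q - j) * z ^ (t - 1 - k) with hr
    have hrR : r ∈ Rg K x y z := mul_mem (mul_mem (pow_mem x_mem _) (pow_mem y_mem _)) (pow_mem z_mem _)
    have hrE := I.lead _ _ (lead_mon (K := K) (x := x) (y := y) (z := z) (i := i') (j := q - j) (k := t - 1 - k)
      (q := q) (t := t) (by omega) (by omega))
    have hdeg : (dg q t i' (q - j) (t - 1 - k) : ℤ) = D + v h := by
      have e1 : ((q - j : ℕ) : ℤ) = q - j := by omega
      have e2 : ((t - 1 - k : ℕ) : ℤ) = t - 1 - k := by omega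
      unfold dg
      push_cast [e1, e2, hi']
      linear_combination (-1 : ℤ) * hDz + hrep
    obtain ⟨d, hd⟩ := hO.res r (hR r hrR)
    have h1 : E v (-(D + v h)) (r - algebraMap K F d) := by
      rw [← hdeg]
      refine hv.E_sub hrE ((hv.G_const d).mono ?_)
      omega
    have hmem : (r - algebraMap K F d) * h ∈ Rg K x y z := by
      refine C.Mreg_mem ((Mreg_R (sub_mem hrR (c_mem d))).mul hM) ?_
      simpa using hO.G_mul hd hE.toG
    have hE2 : E v (-D) ((r - algebraMap K F d) * h) := by
      have := hv.E_mul h1 ⟨hE.1, rfl⟩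
      convert this using 1
      ring
    obtain ⟨n, hn⟩ := C.lead hmem hE2.1
    have hn' := (I.lead _ _ hn).unique hE2
    have hnD : n = D := by omega
    subst hnD
    obtain ⟨i2, j2, k2, hj2, hk2, hdg, -⟩ := hn
    have : dg q t (i2 + 1) j2 k2 = dg q t 0 q (t - 1) := by
      rw [← hdg] at hD
      unfold dg at hD ⊢
      linear_combination hD
    have := dg_inj (by omega) (by omega) C.cop hj2 hk2 le_rfl (by omega) this
    omega
  induction n with
  | zero =>
    intro h hnD hM hE hlt
    obtain ⟨i, j, k, hj, hk, hrep⟩ := C.rep (- v h)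
    refine key h hM hE (by omega) i j k hj hk hrep ?_
    by_contra hi
    have : 0 ≤ i * ((q + 1) * t) := mul_nonneg (by omega) (by positivity)
    have : (0 : ℤ) ≤ j * (q * t) := by positivity
    have : (0 : ℤ) ≤ k * q ^ 3 := by positivity
    push_cast at hlt
    omega
  | succ n ih =>
    intro h hnD hM hE hlt
    obtain ⟨i, j, k, hj, hk, hrep⟩ := C.rep (- v h)
    by_cases hi : i < 0
    · exact key h hM hE (by omega) i j k hj hk hrep hi
    obtain ⟨i', rfl⟩ := Int.eq_ofNat_of_zero_le (not_lt.1 hi)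
    set r := x ^ i' * y ^ j * z ^ k with hr
    have hrR : r ∈ Rg K x y z := mul_mem (mul_mem (pow_mem x_mem _) (pow_mem y_mem _)) (pow_mem z_mem _)
    have hrE := I.lead _ _ (lead_mon (K := K) (x := x) (y := y) (z := z) (i := i') (q := q) (t := t) hj hk)
    have hdeg : (dg q t i' j k : ℤ) = - v h := by
      rw [hrep]; unfold dg; push_cast; ring
    have h0 : E v 0 (h / r) := by
      have := hv.E_div ⟨hE.1, rfl⟩ hrE
      convert this using 1
      omega
    obtain ⟨c, hc⟩ := hv.res _ h0.toG
    have h3 : G v (v h + 1) (h - algebraMap K F c * r) := by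
      have := hv.G_mul hc hrE.toG
      convert this using 1
      · omega
      · have : r ≠ 0 := hrE.1
        rw [← hr]
        field_simp
    have hcr : algebraMap K F c * r ∈ Rg K x y z := mul_mem (c_mem c) hrR
    have hE' : E v' (-1) (h - algebraMap K F c * r) := hO.E_sub hE ((hR _ hcr).mono (by omega))
    refine ih _ (by omega) (hM.sub (Mreg_R hcr)) hE' ?_
    have := h3.le hE'.1
    push_cast at hlt
    omega

end
end YC1


namespace YC1

section
variable {K F : Type} [Field K] [Field F] [Algebra K F] {p a q t e : ℕ} {x y z : F} {v v' : F → ℤ}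

/-- `f` has residue `c` -/
def Rs (K : Type) {F : Type} [Field K] [Field F] [Algebra K F] (v : F → ℤ) (f : F) (c : K) : Prop :=
  G v 1 (f - algebraMap K F c)

theorem OV.Rs_G (h : OV K v) {f : F} {c : K} (hf : Rs K v f c) : G v 0 f := by
  have := h.G_add (G.mono hf (by omega : (0 : ℤ) ≤ 1)) (h.G_const c)
  simpa using this

theorem OV.Rs_mul (h : OV K v) {f g : F} {c d : K} (hf : Rs K v f c) (hg : Rs K v g d) :
    Rs K v (f * g) (c * d) := by
  have h1 : G v 1 ((f - algebraMap K F c) * g) := by simpa using h.G_mul hf (h.Rs_G hg)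
  have h2 : G v 1 (algebraMap K F c * (g - algebraMap K F d)) := by simpa using h.G_mul (h.G_const c) hg
  unfold Rs
  convert h.G_add h1 h2 using 1
  rw [map_mul]; ring

theorem OV.Rs_const (_ : OV K v) (c : K) : Rs K v (algebraMap K F c) c := by
  unfold Rs; rw [sub_self]; exact G_zero _

theorem OV.Rs_pow (h : OV K v) {f : F} {c : K} (hf : Rs K v f c) (n : ℕ) : Rs K v (f ^ n) (c ^ n) := by
  induction n with
  | zero => simpa using h.Rs_const 1
  | succ n ih => rw [pow_succ, pow_succ]; exact h.Rs_mul ih hf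

theorem OV.Rs_add (h : OV K v) {f g : F} {c d : K} (hf : Rs K v f c) (hg : Rs K v g d) :
    Rs K v (f + g) (c + d) := by
  unfold Rs
  convert h.G_add hf hg using 1
  rw [map_add]; ring

theorem OV.Rs_sub (h : OV K v) {f g : F} {c d : K} (hf : Rs K v f c) (hg : Rs K v g d) :
    Rs K v (f - g) (c - d) := by
  unfold Rs
  convert h.G_sub hf hg using 1
  rw [map_sub]; ring

theorem OV.Rs_unique (h : OV K v) {f : F} {c d : K} (hf : Rs K v f c) (hg : Rs K v f d) : c = d := by
  have := h.G_sub hg hf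
  rw [sub_sub_sub_cancel_left, ← map_sub] at this
  exact sub_eq_zero.1 (h.const_of_G_one this)

/-- a place centered at the affine point `(a,b,c)` -/
structure Loc (K : Type) {F : Type} [Field K] [Field F] [Algebra K F] (q t : ℕ) (x y z : F) (v' : F → ℤ)
    (a b c : K) : Prop where
  ov : OV K v'
  R : ∀ f ∈ Rg K x y z, G v' 0 f
  pi : ∃ π, E v' 1 π
  rx : G v' 1 (x - algebraMap K F a)
  ry : G v' 1 (y - algebraMap K F b)
  rz : G v' 1 (z - algebraMap K F c)
  h1 : c ^ t = b ^ (q ^ 2) - b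
  h2 : b ^ (q + 1) = a ^ q + a

theorem Crv.exists_loc (C : Crv K p a q t e x y z) (hO : OV K v') (hR : ∀ f ∈ Rg K x y z, G v' 0 f)
    (hpi : ∃ π, E v' 1 π) : ∃ a b c : K, Loc K q t x y z v' a b c := by
  obtain ⟨a, ha⟩ := hO.res x (hR x x_mem)
  obtain ⟨b, hb⟩ := hO.res y (hR y y_mem)
  obtain ⟨c, hc⟩ := hO.res z (hR z z_mem)
  refine ⟨a, b, c, hO, hR, hpi, ha, hb, hc, ?_, ?_⟩
  · apply hO.Rs_unique (f := z ^ t) (hO.Rs_pow hc t)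
    rw [C.r1]; exact hO.Rs_sub (hO.Rs_pow hb _) hb
  · apply hO.Rs_unique (f := y ^ (q + 1)) (hO.Rs_pow hb _)
    rw [C.r2]; exact hO.Rs_add (hO.Rs_pow ha _) ha

theorem Crv.loc_uu (C : Crv K p a q t e x y z) {a' b c : K} (L : Loc K q t x y z v' a' b c) :
    E v' 0 (uu K q x y a' b) := by
  have hO := L.ov
  have hq := C.q2
  have hq2 : 2 ^ 2 ≤ q ^ 2 := Nat.pow_le_pow_left hq 2
  have h1 : E v' 0 (1 - (y - algebraMap K F b) ^ (q ^ 2 - 1)) := by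
    refine hO.E_sub hO.E_one ((hO.G_pow L.ry (q ^ 2 - 1)).mono ?_)
    omega
  have h2 : E v' 0 (1 + (x - algebraMap K F a') ^ (q - 1)) := by
    refine hO.E_add hO.E_one ((hO.G_pow L.rx (q - 1)).mono ?_)
    omega
  simpa [uu] using hO.E_mul h1 h2

theorem Crv.loc_z (C : Crv K p a q t e x y z) (I : Inf K q t x y z v) {a' b c : K}
    (L : Loc K q t x y z v' a' b c) : E v' 1 (z - algebraMap K F c) := by
  have hO := L.ov
  have hq := C.q2
  have hz0 : z - algebraMap K F c ≠ 0 := by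
    intro h
    have h2 := (C.Ez I).not_G (m := 0) (by rw [sub_eq_zero.1 h]; exact I.ov.G_const c)
    have : (0 : ℤ) < q ^ 3 := by positivity
    omega
  set n := v' (z - algebraMap K F c) with hn
  have hn1 : 1 ≤ n := L.rz.le hz0
  have key : ∀ N : ℕ, ∀ f ∈ Rg K x y z, f ≠ 0 → v' f < N → n ∣ v' f := by
    intro N
    induction N with
    | zero =>
      intro f hf h0 hN
      have := (L.R f hf).le h0
      omega
    | succ N ih =>
      intro f hf h0 hN
      have h3 := (L.R f hf).le h0
      by_cases h4 : v' f = 0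
      · rw [h4]; exact dvd_zero _
      obtain ⟨d, g, hg, hfg⟩ := C.pt L.h1 L.h2 hf
      have hu := C.loc_uu L
      have h5 : G v' 1 ((z - algebraMap K F c) * g) := by simpa using hO.G_mul L.rz (L.R g hg)
      have h6 : G v' 1 (f - algebraMap K F d) := by
        rw [← hfg] at h5
        have := hO.G_mul (hO.E_inv hu).toG h5
        rwa [inv_mul_cancel_left₀ hu.1, neg_zero, zero_add] at this
      have hd : d = 0 := by
        apply hO.Rs_unique (f := f) h6
        right; rw [map_zero, sub_zero]; omega
      rw [hd, map_zero, sub_zero] at hfg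
      have hg0 : g ≠ 0 := by
        rintro rfl
        rw [mul_zero] at hfg
        exact mul_ne_zero hu.1 h0 hfg
      have h7 := hO.mul _ _ hz0 hg0
      rw [← hfg, hO.mul _ _ hu.1 h0, hu.2, ← hn] at h7
      have := ih g hg hg0 (by push_cast at hN; omega)
      rw [show v' f = n + v' g by omega]
      exact dvd_add dvd_rfl this
  have key' : ∀ f ∈ Rg K x y z, f ≠ 0 → n ∣ v' f := fun f hf h0 =>
    key (v' f + 1).toNat f hf h0 (by omega)
  obtain ⟨π, hπ⟩ := L.pi
  obtain ⟨r, hr, s, hs, hs0, hrs⟩ := C.frac π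
  have hr0 : r ≠ 0 := by rintro rfl; exact hπ.1 (by rw [hrs, zero_div])
  have h8 : π * s = r := by rw [hrs]; field_simp
  have h9 := hO.mul _ _ hπ.1 hs0
  rw [h8, hπ.2] at h9
  have h10 : n ∣ 1 := by
    have := dvd_sub (key' r hr hr0) (key' s hs hs0)
    rwa [show v' r - v' s = 1 by omega] at this
  refine ⟨hz0, ?_⟩
  have := Int.eq_one_of_dvd_one (by omega) h10
  omega

theorem Crv.loc_ty (C : Crv K p a q t e x y z) {a' b c : K}
    (L : Loc K q t x y z v' a' b c) :
    G v' 2 (y - algebraMap K F b + algebraMap K F (t * c ^ (t - 1)) * (z - algebraMap K F c)) := by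
  have hO := L.ov
  have hq := C.q2
  have hq2 : 2 ^ 2 ≤ q ^ 2 := Nat.pow_le_pow_left hq 2
  obtain ⟨k, hk⟩ := Polynomial.powAddExpansion (R := Rg K x y z) ⟨algebraMap K F c, c_mem c⟩
    ⟨z - algebraMap K F c, sub_mem z_mem (c_mem c)⟩ t
  have hk' := congrArg (Subtype.val) hk
  simp only [AddMemClass.mk_add_mk, add_sub_cancel, SubmonoidClass.mk_pow, Subalgebra.coe_add,
    Subalgebra.coe_mul, Subalgebra.coe_pow, SubringClass.coe_natCast] at hk'
  have h1 : G v' 2 ((k : F) * (z - algebraMap K F c) ^ 2) := by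
    simpa using hO.G_mul (L.R _ k.2) (hO.G_pow L.rz 2)
  have h2 : G v' 2 ((y - algebraMap K F b) ^ (q ^ 2)) := by
    refine (hO.G_pow L.ry (q ^ 2)).mono ?_
    push_cast; 
    have : (4 : ℤ) ≤ (q : ℤ) ^ 2 := by exact_mod_cast hq2
    omega
  have h3 : (algebraMap K F c) ^ t = (algebraMap K F b) ^ (q ^ 2) - algebraMap K F b := by
    rw [← map_pow, L.h1, map_sub, map_pow]
  have r1 := C.r1
  convert hO.G_sub h2 h1 using 1
  rw [C.frobF_sub, map_mul, map_natCast, map_pow]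
  linear_combination r1 - hk' - h3

theorem Crv.loc_y (C : Crv K p a q t e x y z) (I : Inf K q t x y z v) {a' b c : K}
    (L : Loc K q t x y z v' a' b c) (hc : c ≠ 0) : E v' 1 (y - algebraMap K F b) := by
  have hO := L.ov
  have h1 := C.loc_ty L
  have h2 : E v' 1 (algebraMap K F (t * c ^ (t - 1)) * (z - algebraMap K F c)) := by
    have := hO.E_mul (hO.E_const (F := F) (mul_ne_zero C.tK (pow_ne_zero (t - 1) hc))) (C.loc_z I L)
    simpa using this
  have := hO.E_neg (hO.E_sub h2 h1)
  simpa using this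

theorem Crv.loc_tx (C : Crv K p a q t e x y z) {a' b c : K}
    (L : Loc K q t x y z v' a' b c) :
    G v' 2 (x - algebraMap K F a' - algebraMap K F (b ^ q) * (y - algebraMap K F b)) := by
  have hO := L.ov
  have hq := C.q2
  have h1 : G v' 2 ((x - algebraMap K F a') ^ q) := by
    refine (hO.G_pow L.rx q).mono ?_
    omega
  have h2 : G v' 2 ((y - algebraMap K F b) ^ q * y) := by
    refine (hO.G_mul (hO.G_pow L.ry q) (L.R y y_mem)).mono ?_
    omega
  have h3 : (algebraMap K F b) ^ (q + 1) = (algebraMap K F a') ^ q + algebraMap K F a' := by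
    rw [← map_pow, L.h2, map_add, map_pow]
  have fr : ∀ f g : F, (f - g) ^ q = f ^ q - g ^ q := fun f g => by simpa using C.frobF_sub 1 f g
  have r2 := C.r2
  convert hO.G_sub h2 h1 using 1
  rw [fr, fr, map_pow]
  linear_combination h3 - r2

/-- tangent function at the point -/
theorem Crv.loc_l [IsAlgClosed K] (C : Crv K p a q t e x y z) (I : Inf K q t x y z v) {a' b c : K}
    (L : Loc K q t x y z v' a' b c) (hc : c ≠ 0) :
    E v' q (x + algebraMap K F (a' ^ q) - algebraMap K F (b ^ q) * y) := by
  have hO := L.ov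
  have hq := C.q2
  obtain ⟨b', hb'⟩ := IsAlgClosed.exists_pow_nat_eq b (by omega : 0 < q)
  have hne : b ^ q - b' ≠ 0 := by
    intro h
    apply hc
    have : c ^ t = 0 := by
      rw [L.h1, pow_two, pow_mul, sub_eq_zero.1 h, hb', sub_self]
    exact pow_eq_zero_iff (by have := C.ht; omega) |>.1 this
  have h1 : E v' 1 (x - algebraMap K F a' - algebraMap K F b' * (y - algebraMap K F b)) := by
    have h2 : E v' 1 (algebraMap K F (b ^ q - b') * (y - algebraMap K F b)) := by
      simpa using hO.E_mul (hO.E_const (F := F) hne) (C.loc_y I L hc)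
    convert hO.E_add h2 (C.loc_tx L) using 1
    rw [map_sub]; ring
  have h3 := hO.E_pow h1 q
  have h4 := hO.G_pow L.ry (q + 1)
  have fr : ∀ f g : F, (f - g) ^ q = f ^ q - g ^ q := fun f g => by simpa using C.frobF_sub 1 f g
  have r2 := C.r2
  convert hO.E_add (hO.E_neg h3) (h4.mono (m := q * 1 + 1) (by push_cast; omega)) using 1
  · ring
  · rw [pow_succ (y - algebraMap K F b) q, fr, fr, fr, mul_pow, fr, ← map_pow, ← map_pow, ← map_pow, hb']
    simp only [map_pow]
    linear_combination -r2

end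
end YC1


namespace YC1

section
variable {K F : Type} [Field K] [Field F] [Algebra K F] {p a q t e : ℕ} {x y z : F} {v v' : F → ℤ}

theorem Crv.inv0 [IsAlgClosed K] (C : Crv K p a q t e x y z) (I : Inf K q t x y z v) {σ : F ≃ₐ[K] F}
    (hσ : ¬ Bset K v σ) {f : F} (hf : f ∈ Rg K x y z) : G v 0 (σ.symm f) := by
  obtain ⟨V, hK, hV⟩ := C.Vinf I
  rcases C.dich I V hK σ.symm with h | h
  · exact (hV _).1 (h f hf)
  · exfalso
    apply hσ
    intro g
    rw [← h, AlgEquiv.symm_apply_apply, hV]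

theorem Crv.close [IsAlgClosed K] (C : Crv K p a q t e x y z) (I : Inf K q t x y z v) {σ : F ≃ₐ[K] F}
    (hσ : ¬ Bset K v σ) {a' b c : K} (L : Loc K q t x y z (fun f => v (σ f)) a' b c)
    {f g : F} (hf : f ∈ Rg K x y z) (hg : g ∈ Rg K x y z) {m : ℤ} {d : ℕ} (h1 : E v (-(m + 1)) f)
    (h2 : E (fun f => v (σ f)) m g) (h3 : G v (-d) g)
    (hd : d + (q + 1) * t < q ^ 2 * t + (t - 1) * q ^ 3) : False := by
  refine C.gap I L.ov L.R (D := q ^ 2 * t + (t - 1) * q ^ 3 - (q + 1) * t) (by omega) (d + 1)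
    (σ.symm f * g) (by omega) ((C.Mreg_symm I σ hf).mul (Mreg_R hg)) ?_ ?_
  · have h4 : E (fun f => v (σ f)) (-(m + 1)) (σ.symm f) := by
      rw [E_comp, AlgEquiv.apply_symm_apply]; exact h1
    have := L.ov.E_mul h4 h2
    convert this using 1
    ring
  · have h5 := I.ov.G_mul (C.inv0 I hσ hf) h3
    have h0 : σ.symm f * g ≠ 0 := mul_ne_zero (by simpa using h1.1) h2.1
    have := h5.le h0
    push_cast
    omega

theorem Crv.Gl (C : Crv K p a q t e x y z) (I : Inf K q t x y z v) (α β : K) :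
    G v (-((q + 1) * t : ℤ)) (x + algebraMap K F α - algebraMap K F β * y) := by
  have hO := I.ov
  have h1 := (C.Ex I).toG
  have h2 : G v (-((q + 1) * t : ℤ)) (algebraMap K F α) := (hO.G_const α).mono (by
    have : (0 : ℤ) ≤ (q + 1) * t := by positivity
    omega)
  have h3 : G v (-((q + 1) * t : ℤ)) (algebraMap K F β * y) :=
    (hO.G_mul (hO.G_const β) (C.Ey I).toG).mono (by
      have : ((q + 1) * t : ℤ) = q * t + t := by ring
      omega)
  exact hO.G_sub (hO.G_add h1 h2) h3

theorem Crv.Gyb (C : Crv K p a q t e x y z) (I : Inf K q t x y z v) (b : K) :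
    G v (-(q * t : ℤ)) (y - algebraMap K F b) := by
  have hO := I.ov
  refine hO.G_sub (C.Ey I).toG ((hO.G_const b).mono ?_)
  have : (0 : ℤ) ≤ q * t := by positivity
  omega

theorem Crv.no_c_gen [IsAlgClosed K] (C : Crv K p a q t e x y z) (I : Inf K q t x y z v) {σ : F ≃ₐ[K] F}
    (hσ : ¬ Bset K v σ) {a' b c : K} (L : Loc K q t x y z (fun f => v (σ f)) a' b c) (hc : c ≠ 0)
    (he : 2 ≤ e) : False := by
  have hq := C.q2
  have ht := C.ht
  have hO := L.ov
  have hv := I.ov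
  obtain ⟨t', rfl⟩ : ∃ t', t = t' + 1 := ⟨t - 1, by omega⟩
  obtain ⟨q', rfl⟩ : ∃ q', q = q' + 1 := ⟨q - 1, by omega⟩
  set l := x + algebraMap K F (a' ^ (q' + 1)) - algebraMap K F (b ^ (q' + 1)) * y with hl
  have hlR : l ∈ Rg K x y z := sub_mem (add_mem x_mem (c_mem _)) (mul_mem (c_mem _) y_mem)
  have hyR : y - algebraMap K F b ∈ Rg K x y z := sub_mem y_mem (c_mem _)
  refine C.close I hσ L (f := y) (g := l ^ t' * (y - algebraMap K F b) ^ q') y_mem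
    (mul_mem (pow_mem hlR _) (pow_mem hyR _)) (m := (q' + 1) * (t' + 1) - 1)
    (d := t' * ((q' + 2) * (t' + 1)) + q' * ((q' + 1) * (t' + 1))) ?_ ?_ ?_ ?_
  · have := C.Ey I
    convert this using 1
    push_cast; ring
  · have := hO.E_mul (hO.E_pow (C.loc_l I L hc) t') (hO.E_pow (C.loc_y I L hc) q')
    convert this using 1
    push_cast; ring
  · have := hv.G_mul (hv.G_pow (C.Gl I (a' ^ (q' + 1)) (b ^ (q' + 1))) t') (hv.G_pow (C.Gyb I b) q')
    convert this using 1
    push_cast; ring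
  · have h1 := C.teq
    have h2 : (t' + 1) * 2 * (q' + 1 + 1) ≤ (q' + 1) ^ 3 + 1 := by
      rw [← h1]; gcongr
    simp only [Nat.add_sub_cancel]
    have h3 := Nat.mul_le_mul_left t' h2
    have h4 : 1 ≤ t' := by omega
    have h5 : 1 ≤ q' := by omega
    have h6 : 1 * 1 ≤ t' * q' := Nat.mul_le_mul h4 h5
    nlinarith [Nat.mul_le_mul_left t' h6, Nat.mul_le_mul_left t' h4]

end
end YC1


namespace YC1

section
variable {K F : Type} [Field K] [Field F] [Algebra K F] {p a q t e : ℕ} {x y z : F} {v v' : F → ℤ}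

theorem Crv.qK (C : Crv K p a q t e x y z) : (q : K) = 0 := by
  have := C.chK
  rw [C.hq, Nat.cast_pow, CharP.cast_eq_zero, zero_pow C.ha.ne']

theorem Crv.gk_id (C : Crv K p a q t 1 x y z) : x ^ (q ^ 3) + x = y ^ (q ^ 3 + 1) + z ^ (q ^ 3 + 1) := by
  have h1 := C.teq
  rw [mul_one] at h1
  have r1 := C.r1
  have r2 := C.r2
  have fr : ∀ f g : F, (f + g) ^ q = f ^ q + g ^ q := fun f g => by simpa using C.frobF 1 f g
  have fr' : ∀ f g : F, (f - g) ^ q = f ^ q - g ^ q := fun f g => by simpa using C.frobF_sub 1 f g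
  have k1 : (y ^ q) ^ q * y ^ q = (x ^ q) ^ q + x ^ q := by
    have := congrArg (· ^ q) r2
    simp only [pow_succ, mul_pow, fr] at this
    exact this
  have k2 : ((y ^ q) ^ q) ^ q * (y ^ q) ^ q = ((x ^ q) ^ q) ^ q + (x ^ q) ^ q := by
    have := congrArg (· ^ q) k1
    simp only [mul_pow, fr] at this
    exact this
  have k3 : z ^ (q ^ 3 + 1) = (((y ^ q) ^ q) ^ q - y ^ q) * ((y ^ q) ^ q - y) := by
    rw [← h1, pow_mul, r1, pow_succ, fr', pow_two, pow_mul]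
  have k4 : ∀ f : F, f ^ (q ^ 3) = ((f ^ q) ^ q) ^ q := by
    intro f; rw [← pow_mul, ← pow_mul]; congr 1; ring
  rw [k3, k4, pow_succ y (q ^ 3), k4]
  rw [pow_succ] at r2
  linear_combination k1 - k2 - r2

theorem OV.pow_resid (h : OV K v) {f g : F} {c : K} (hg : E v 1 g) (hf : G v 2 (f - algebraMap K F c * g)) (n : ℕ) :
    G v (n + 1) (f ^ n - algebraMap K F (c ^ n) * g ^ n) := by
  have h1 : Rs K v (f / g) c := by
    have := h.G_mul hf (h.E_inv hg).toG
    unfold Rs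
    rw [show (1 : ℤ) = 2 + -1 by norm_num]; convert this using 1
    have := hg.1
    rw [sub_mul, mul_assoc, mul_inv_cancel₀ this, mul_one, div_eq_mul_inv]
  have h2 := h.Rs_pow h1 n
  have := h.G_mul h2 (h.E_pow hg n).toG
  convert this using 1
  · ring
  · have := hg.1
    rw [div_pow, sub_mul, div_mul_cancel₀ _ (pow_ne_zero n this)]

theorem Crv.gk_W (C : Crv K p a q t 1 x y z) {a' b c b3 c3 : K} (hb : b3 ^ (q ^ 3) = b) (hc : c3 ^ (q ^ 3) = c) :
    x + algebraMap K F (a' ^ (q ^ 3)) - algebraMap K F (b ^ (q ^ 3)) * y - algebraMap K F (c ^ (q ^ 3)) * z =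
    ((y - algebraMap K F b) ^ (q ^ 3 + 1) + (z - algebraMap K F c) ^ (q ^ 3 + 1)) -
    (x - algebraMap K F a' - algebraMap K F b3 * (y - algebraMap K F b) -
      algebraMap K F c3 * (z - algebraMap K F c)) ^ (q ^ 3) := by
  have h := C.gk_id
  rw [pow_succ (y - algebraMap K F b), pow_succ (z - algebraMap K F c)]
  simp only [C.frobF_sub, mul_pow]
  rw [← map_pow (algebraMap K F) b3, ← map_pow (algebraMap K F) c3, hb, hc]
  simp only [map_pow]
  linear_combination h

theorem Crv.no_c_gk [IsAlgClosed K] (C : Crv K p a q t 1 x y z) (I : Inf K q t x y z v) {σ : F ≃ₐ[K] F}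
    (hσ : ¬ Bset K v σ) {a' b c : K} (L : Loc K q t x y z (fun f => v (σ f)) a' b c) (hc : c ≠ 0) : False := by
  have hq := C.q2
  have ht := C.ht
  have hO := L.ov
  have hv := I.ov
  have h1 := C.teq
  rw [mul_one] at h1
  have hte := C.hte
  rw [mul_one] at hte
  have hq3 : 2 ^ 3 ≤ q ^ 3 := Nat.pow_le_pow_left hq 3
  have hq30 : 0 < q ^ 3 := by omega
  obtain ⟨b3, hb3⟩ := IsAlgClosed.exists_pow_nat_eq b hq30
  obtain ⟨c3, hc3⟩ := IsAlgClosed.exists_pow_nat_eq c hq30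
  have htK : (t : K) = 1 := by
    have := congrArg (Nat.cast : ℕ → K) hte
    push_cast at this
    rw [C.qK] at this
    simpa using this
  have hty := C.loc_ty L
  have htx := C.loc_tx L
  have hz := C.loc_z I L
  have hy := C.loc_y I L hc
  rw [htK, one_mul] at hty
  set μ := c ^ (t - 1) with hμ
  set κ := -(b ^ q - b3) * μ - c3 with hκ
  have hW := C.gk_W (a' := a') hb3 hc3
  set W := x + algebraMap K F (a' ^ (q ^ 3)) - algebraMap K F (b ^ (q ^ 3)) * y -
    algebraMap K F (c ^ (q ^ 3)) * z with hWdef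
  set u := x - algebraMap K F a' - algebraMap K F b3 * (y - algebraMap K F b) -
      algebraMap K F c3 * (z - algebraMap K F c) with hu
  have huκ : G (fun f => v (σ f)) 2 (u - algebraMap K F κ * (z - algebraMap K F c)) := by
    have h2 : G (fun f => v (σ f)) 2 (algebraMap K F (b ^ q - b3) * (y - algebraMap K F b + algebraMap K F μ * (z - algebraMap K F c))) := by
      simpa using hO.G_mul (hO.G_const (b ^ q - b3)) hty
    convert hO.G_add htx h2 using 1
    rw [hu, hκ]
    simp only [map_sub, map_mul, map_neg]
    ring
  have hWR : W ∈ Rg K x y z :=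
    sub_mem (sub_mem (add_mem x_mem (c_mem _)) (mul_mem (c_mem _) y_mem)) (mul_mem (c_mem _) z_mem)
  have hWv : G v (-((q + 1) * t : ℤ)) W := by
    refine hv.G_sub (C.Gl I _ _) ?_
    refine (hv.G_mul (hv.G_const _) (C.Ez I).toG).mono ?_
    have : ((q + 1) * t : ℤ) = q ^ 3 + 1 := by rw [mul_comm]; exact_mod_cast h1
    omega
  have hdeg : (q + 1) * t + (q + 1) * t < q ^ 2 * t + (t - 1) * q ^ 3 := by
    have h8 : q + 2 ≤ q ^ 2 := by nlinarith
    have h9 : 1 ≤ t - 1 := by omega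
    have : t * (q + 1) ≤ (t - 1) * q ^ 3 + 1 := by
      rw [h1]
      have := Nat.mul_le_mul_right (q ^ 3) h9
      omega
    nlinarith
  by_cases hk : κ = 0
  · rw [hk, map_zero, zero_mul, sub_zero] at huκ
    have hμ0 : (-μ) ^ (q ^ 3 + 1) + 1 ≠ 0 := by
      intro h0
      rw [hκ] at hk
      have h3 : (b ^ (q ^ 2 * q ^ 2) - b) * (-μ) ^ (q ^ 3) = c := by
        have h4 : (b ^ q - b3) * (-μ) = c3 := by linear_combination hk
        have h5 := congrArg (· ^ (q ^ 3)) h4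
        simp only [mul_pow] at h5
        rw [hc3, C.frobK_sub, hb3, ← pow_mul] at h5
        rw [← h5]
        congr 3
        ring
      have h6 : b ^ (q ^ 2 * q ^ 2) - b = c ^ t := by
        have h7 : c * μ = c ^ t := by rw [hμ, ← pow_succ']; congr 1; omega
        rw [pow_succ] at h0
        linear_combination h7 + (b ^ (q ^ 2 * q ^ 2) - b) * h0 + μ * h3
      rw [L.h1] at h6
      have h8 : (b ^ (q ^ 2) - b) ^ (q ^ 2) = 0 := by
        rw [C.frobK_sub, ← pow_mul]
        linear_combination h6
      have h9 := pow_eq_zero_iff (by positivity) |>.1 h8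
      rw [← L.h1] at h9
      exact hc (pow_eq_zero_iff (by omega) |>.1 h9)
    have hyN := hO.pow_resid (c := -μ) hz (by rw [map_neg, neg_mul, sub_neg_eq_add]; exact hty) (q ^ 3 + 1)
    have hWE : E (fun f => v (σ f)) (q ^ 3 + 1) W := by
      have h2 : E (fun f => v (σ f)) (q ^ 3 + 1) (algebraMap K F ((-μ) ^ (q ^ 3 + 1) + 1) * (z - algebraMap K F c) ^ (q ^ 3 + 1)) := by
        have := hO.E_mul (hO.E_const (F := F) hμ0) (hO.E_pow hz (q ^ 3 + 1))
        convert this using 1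
        push_cast; ring
      have h3 : G (fun f => v (σ f)) (q ^ 3 + 1 + 1) (u ^ (q ^ 3)) := by
        refine (hO.G_pow huκ (q ^ 3)).mono ?_
        have : (8 : ℤ) ≤ (q : ℤ) ^ 3 := by exact_mod_cast hq3
        push_cast
        omega
      have h4 : G (fun f => v (σ f)) (q ^ 3 + 1 + 1) ((y - algebraMap K F b) ^ (q ^ 3 + 1) - algebraMap K F ((-μ) ^ (q ^ 3 + 1)) * (z - algebraMap K F c) ^ (q ^ 3 + 1)) := by
        exact_mod_cast hyN
      convert hO.E_add h2 (hO.G_sub h4 h3) using 1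
      rw [hW, map_add, map_one]
      ring
    obtain ⟨r, rfl⟩ : ∃ r, q = r + 2 := ⟨q - 2, by omega⟩
    set l := x + algebraMap K F (a' ^ (r + 2)) - algebraMap K F (b ^ (r + 2)) * y with hl
    have hlR : l ∈ Rg K x y z := sub_mem (add_mem x_mem (c_mem _)) (mul_mem (c_mem _) y_mem)
    have hyR : y - algebraMap K F b ∈ Rg K x y z := sub_mem y_mem (c_mem _)
    have htz : (t : ℤ) = (r + 2) ^ 2 - (r + 2) + 1 := by
      have : (t : ℤ) + (r + 2) = (r + 2) ^ 2 + 1 := by exact_mod_cast hte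
      omega
    refine C.close I hσ L (f := y ^ 2) (g := W * l ^ ((r + 1) ^ 2) * (y - algebraMap K F b) ^ r) (pow_mem y_mem _)
      (mul_mem (mul_mem hWR (pow_mem hlR _)) (pow_mem hyR _)) (m := 2 * ((r + 2) * t) - 1)
      (d := (r + 2 + 1) * t + (r + 1) ^ 2 * ((r + 2 + 1) * t) + r * ((r + 2) * t)) ?_ ?_ ?_ ?_
    · have := hv.E_pow (C.Ey I) 2
      convert this using 1
      push_cast; ring
    · have := hO.E_mul (hO.E_mul hWE (hO.E_pow (C.loc_l I L hc) ((r + 1) ^ 2))) (hO.E_pow hy r)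
      convert this using 1
      push_cast [htz]; ring
    · have := hv.G_mul (hv.G_mul hWv (hv.G_pow (C.Gl I (a' ^ (r + 2)) (b ^ (r + 2))) ((r + 1) ^ 2))) (hv.G_pow (C.Gyb I b) r)
      convert this using 1
      push_cast; ring
    · zify [show 1 ≤ t by omega]
      rw [htz]
      have : (0 : ℤ) ≤ r := by positivity
      ring_nf
      nlinarith [pow_nonneg this 2, pow_nonneg this 3, pow_nonneg this 4]
  · refine C.close I hσ L (f := x) (g := W) x_mem hWR (m := q ^ 3) (d := (q + 1) * t) ?_ ?_ ?_ hdeg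
    · have := C.Ex I
      convert this using 2
      rw [mul_comm]; exact_mod_cast h1.symm
    · have h2 : E (fun f => v (σ f)) 1 u := by
        have h3 : E (fun f => v (σ f)) 1 (algebraMap K F κ * (z - algebraMap K F c)) := by
          simpa using hO.E_mul (hO.E_const (F := F) hk) hz
        simpa using hO.E_add h3 huκ
      have h4 : E (fun f => v (σ f)) (q ^ 3) (- u ^ (q ^ 3)) := by
        have := hO.E_neg (hO.E_pow h2 (q ^ 3))
        simpa using this
      have h5 : G (fun f => v (σ f)) (q ^ 3 + 1) ((y - algebraMap K F b) ^ (q ^ 3 + 1)) := by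
        convert hO.G_pow L.ry (q ^ 3 + 1) using 1; push_cast; ring
      have h6 : G (fun f => v (σ f)) (q ^ 3 + 1) ((z - algebraMap K F c) ^ (q ^ 3 + 1)) := by
        convert hO.G_pow L.rz (q ^ 3 + 1) using 1; push_cast; ring
      rw [hW, sub_eq_neg_add]
      exact hO.E_add h4 (hO.G_add h5 h6)
    · convert hWv using 1
      push_cast; ring

theorem Crv.no_c [IsAlgClosed K] (C : Crv K p a q t e x y z) (I : Inf K q t x y z v) {σ : F ≃ₐ[K] F}
    (hσ : ¬ Bset K v σ) {a' b c : K} (L : Loc K q t x y z (fun f => v (σ f)) a' b c) : c = 0 := by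
  by_contra hc
  have he := C.e1
  rcases Nat.lt_or_ge 1 e with h | h
  · exact C.no_c_gen I hσ L hc h
  · obtain rfl : e = 1 := by omega
    exact C.no_c_gk I hσ L hc

end
end YC1


namespace YC1

section
variable {K F : Type} [Field K] [Field F] [Algebra K F] {p a q t e : ℕ} {x y z : F} {v v' : F → ℤ}

/-- stabilizer of the place at infinity -/
def Bgp (K : Type) {F : Type} [Field K] [Field F] [Algebra K F] (v : F → ℤ) : Subgroup (F ≃ₐ[K] F) where
  carrier := {σ | Bset K v σ}
  mul_mem' := by
    intro σ τ hσ hτ f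
    rw [AlgEquiv.mul_apply, hσ, hτ]
  one_mem' := fun f => by rw [AlgEquiv.one_apply]
  inv_mem' := by
    intro σ hσ f
    have := hσ (σ⁻¹ f)
    rw [← AlgEquiv.mul_apply, mul_inv_cancel, AlgEquiv.one_apply] at this
    exact this.symm

theorem mem_Bgp {σ : F ≃ₐ[K] F} : σ ∈ Bgp K v ↔ Bset K v σ := Iff.rfl

theorem Crv.B_shp [IsAlgClosed K] (C : Crv K p a q t e x y z) (I : Inf K q t x y z v) {σ : F ≃ₐ[K] F}
    (hσ : Bset K v σ) : ∃ l β ε : K, Par q t l β ε ∧ Shp q t x y z σ l β ε := by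
  obtain ⟨l, β, ε, h1, h2, h3, h4, h5, h6⟩ := C.B_form I hσ
  exact ⟨l, β, ε, ⟨h1, h2, h3⟩, h4, h5, h6⟩

/-- translation parameters -/
def Tp (K : Type) [Field K] (q : ℕ) : Type := Σ b : {b : K // b ^ (q ^ 2) = b}, {d : K // d ^ q + d = b.1 ^ (q + 1)}

theorem Crv.T_par (_ : Crv K p a q t e x y z) (u : Tp K q) : Par q t (1 : K) u.1.1 u.2.1 :=
  ⟨one_pow _, u.1.2, u.2.2⟩

theorem Crv.decomp [IsAlgClosed K] (C : Crv K p a q t e x y z) (I : Inf K q t x y z v) {w : F ≃ₐ[K] F}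
    (hw : w x = x⁻¹) {σ : F ≃ₐ[K] F}
    (hσ : ¬ Bset K v σ) : ∃ T : Tp K q, ∀ u : F ≃ₐ[K] F, Shp q t x y z u 1 T.1.1 T.2.1 →
      Bset K v (σ * u * w) := by
  obtain ⟨V, hK, hV⟩ := C.Vinf I
  have hR : ∀ f ∈ Rg K x y z, G v 0 (σ f) := by
    rcases C.dich I V hK σ with h1 | h1
    · intro f hf; exact (hV _).1 (h1 f hf)
    · exact absurd (fun f => by rw [← hV, h1]) hσ
  obtain ⟨π, hπ⟩ := C.exists_pi I
  obtain ⟨a', b, c, L⟩ := C.exists_loc (v' := fun f => v (σ f)) (I.ov.comp σ) (fun f hf => (G_comp σ).2 (hR f hf))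
    ⟨σ.symm π, (E_comp σ).2 (by rwa [AlgEquiv.apply_symm_apply])⟩
  have hc := C.no_c I hσ L
  have h1 := L.h1
  have h2 := L.h2
  rw [hc, zero_pow (by have := C.ht; omega)] at h1
  have hb : b ^ (q ^ 2) = b := (sub_eq_zero.1 h1.symm)
  have frs : ∀ f g : K, (f - g) ^ q = f ^ q - g ^ q := fun f g => by simpa using C.frobK_sub 1 f g
  have hneg : ∀ f : K, (-f) ^ q = - f ^ q := fun f => by
    have := frs 0 f
    rwa [zero_sub, zero_pow (by have := C.q2; omega), zero_sub] at this
  have hβ : (-b) ^ (q ^ 2) = -b := by rw [pow_two, pow_mul, hneg, hneg, ← pow_mul, ← pow_two, hb]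
  have hε : (b ^ (q + 1) - a') ^ q + (b ^ (q + 1) - a') = (-b) ^ (q + 1) := by
    rw [frs, pow_succ (-b), hneg, pow_succ b, mul_pow, ← pow_mul, ← pow_two, hb]
    rw [pow_succ] at h2
    linear_combination h2
  refine ⟨⟨⟨-b, hβ⟩, ⟨b ^ (q + 1) - a', hε⟩⟩, ?_⟩
  intro u hu
  apply C.B_of I
  have hux : (σ * u * w) x = (σ (u x))⁻¹ := by
    rw [AlgEquiv.mul_apply, AlgEquiv.mul_apply, hw, map_inv₀, map_inv₀]
  rw [hux, hu.1]
  simp only [one_pow, map_one, one_mul]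
  intro hG
  have h0 : u x ≠ 0 := by simpa using (C.Ex I).1
  have h3 : G v 1 (σ (x + algebraMap K F ((-b) ^ q) * y + algebraMap K F (b ^ (q + 1) - a'))) := by
    rw [← G_comp]
    convert L.ov.G_add L.rx (L.ov.G_mul (L.ov.G_const ((-b) ^ q)) L.ry) using 1
    rw [hneg, pow_succ]
    simp only [map_neg, map_sub, map_mul]
    ring
  have h4 : σ (x + algebraMap K F ((-b) ^ q) * y + algebraMap K F (b ^ (q + 1) - a')) ≠ 0 := by
    rw [map_ne_zero_iff _ σ.injective]
    rw [hu.1] at h0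
    simpa using h0
  have h5 := h3.le h4
  have h6 := hG.le (inv_ne_zero h4)
  rw [I.ov.v_inv h4] at h6
  omega

theorem Crv.w_not (C : Crv K p a q t e x y z) (I : Inf K q t x y z v) {w : F ≃ₐ[K] F}
    (hw : w x = x⁻¹) : ¬ Bset K v w := by
  intro h
  apply C.x_not I
  rw [← h x, hw]
  refine (I.ov.E_inv (C.Ex I)).toG.mono ?_
  have : (0 : ℤ) ≤ (q + 1) * t := by positivity
  omega

theorem Crv.y_const (C : Crv K p a q t e x y z) (I : Inf K q t x y z v) {α β γ δ : K}
    (h : algebraMap K F α * y + algebraMap K F β = algebraMap K F γ * y + algebraMap K F δ) : α = γ ∧ β = δ := by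
  have hαγ : α = γ := by
    by_contra hne
    have h1 : algebraMap K F (α - γ) * y = algebraMap K F (δ - β) := by
      rw [map_sub, map_sub]; linear_combination h
    have h2 := I.ov.E_mul (I.ov.E_const (F := F) (sub_ne_zero.2 hne)) (C.Ey I)
    rw [h1] at h2
    have h3 := h2.not_G (I.ov.G_const _)
    have hq := C.q2
    have ht := C.ht
    have : (0 : ℤ) < q * t := by positivity
    omega
  subst hαγ
  exact ⟨rfl, (algebraMap K F).injective (add_left_cancel h)⟩

theorem Crv.wrw [IsAlgClosed K] (C : Crv K p a q t e x y z) (I : Inf K q t x y z v) {w : F ≃ₐ[K] F}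
    (hw : w x = x⁻¹) (hwy : w y = y / x) {ρ : F ≃ₐ[K] F} {l β ε : K} (hp : Par q t l β ε)
    (h : Shp q t x y z ρ l β ε) (hB : Bset K v (w * ρ * w)) : β = 0 ∧ ε = 0 := by
  have hx0 := (C.Ex I).1
  have hq := C.q2
  have ht := C.ht
  have h1 : (w * ρ * w) x = (w (ρ x))⁻¹ := by
    rw [AlgEquiv.mul_apply, AlgEquiv.mul_apply, hw, map_inv₀, map_inv₀]
  have h2 : ¬ G v 0 ((w (ρ x))⁻¹) := by
    rw [← h1, hB]; exact C.x_not I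
  have h0 : w (ρ x) ≠ 0 := by simpa using hx0
  have h3 : G v 1 (w (ρ x)) := by
    right
    by_contra h3
    apply h2
    right
    rw [I.ov.v_inv h0]; omega
  have hε : ε = 0 := by
    apply I.ov.Rs_unique (f := w (ρ x))
    · unfold Rs
      rw [h.1]
      simp only [map_add, map_mul, AlgEquiv.commutes, hw, hwy]
      rw [add_sub_cancel_right]
      refine I.ov.G_add ?_ ?_
      · refine (I.ov.G_mul (I.ov.G_const _) (I.ov.E_inv (C.Ex I)).toG).mono ?_
        have : (0 : ℤ) < (q + 1) * t := by positivity
        omega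
      · rw [← map_mul]
        refine (I.ov.G_mul (I.ov.G_const _) (I.ov.E_div (C.Ey I) (C.Ex I)).toG).mono ?_
        have : ((q + 1) * t : ℤ) = q * t + t := by ring
        omega
    · unfold Rs; rw [map_zero, sub_zero]; exact h3
  refine ⟨?_, hε⟩
  have h4 := hp.2.2
  rw [hε, zero_pow (by omega), add_zero] at h4
  exact pow_eq_zero_iff (by omega) |>.1 h4.symm

theorem Crv.T_inj [IsAlgClosed K] (C : Crv K p a q t e x y z) (I : Inf K q t x y z v) {w : F ≃ₐ[K] F}
    (hw : w x = x⁻¹) (hwy : w y = y / x) {u u' : F ≃ₐ[K] F} {β ε β' ε' : K}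
    (hu : Shp q t x y z u 1 β ε) (hu' : Shp q t x y z u' 1 β' ε') (hB : Bset K v (w * (u⁻¹ * u') * w)) :
    β = β' ∧ ε = ε' := by
  have hub := C.shp_B I one_ne_zero hu
  have hub' := C.shp_B I one_ne_zero hu'
  have hρ : Bset K v (u⁻¹ * u') := mem_Bgp.1 (mul_mem (inv_mem (mem_Bgp.2 hub)) (mem_Bgp.2 hub'))
  obtain ⟨l, β₀, ε₀, hp, hs⟩ := C.B_shp I hρ
  obtain ⟨rfl, rfl⟩ := C.wrw I hw hwy hp hs hB
  have e1 : u' = u * (u⁻¹ * u') := by group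
  have hy : u' y = u ((u⁻¹ * u') y) := by rw [← AlgEquiv.mul_apply, ← e1]
  have hx : u' x = u ((u⁻¹ * u') x) := by rw [← AlgEquiv.mul_apply, ← e1]
  rw [hs.2.1, hu'.2.1, map_zero, add_zero, map_mul, AlgEquiv.commutes, hu.2.1, mul_add, ← mul_assoc, ← map_mul, ← map_mul] at hy
  obtain ⟨h1, h2⟩ := C.y_const I hy
  have hl : l ^ t = 1 := by simpa using h1.symm
  rw [hl] at h2
  have hβ : β = β' := by simpa using h2.symm
  subst hβ
  refine ⟨rfl, ?_⟩
  rw [hs.1, hl, hu'.1] at hx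
  rw [zero_pow (by have := C.q2; omega)] at hx
  simp only [one_pow, map_one, one_mul, map_zero, zero_mul, add_zero] at hx
  rw [hu.1] at hx
  simp only [one_pow, map_one, one_mul] at hx
  exact ((algebraMap K F).injective (add_left_cancel hx)).symm

/-! ### counting -/

theorem card_roots [IsAlgClosed K] (P : Polynomial K) (hP : P.Separable) (Q : K → Prop)
    (hQ : ∀ c, Q c ↔ P.eval c = 0) : Nat.card {c : K // Q c} = P.natDegree ∧ Finite {c : K // Q c} := by
  have h1 := Polynomial.card_rootSet_eq_natDegree (K := K) hP (IsAlgClosed.splits _)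
  have e : {c : K // Q c} ≃ P.rootSet K := Equiv.subtypeEquivRight (fun c => by
    rw [Polynomial.mem_rootSet_of_ne hP.ne_zero, hQ, Polynomial.coe_aeval_eq_eval])
  refine ⟨?_, Finite.of_equiv _ e.symm⟩
  rw [Nat.card_congr e, Nat.card_eq_fintype_card, h1]

theorem Crv.card_l [IsAlgClosed K] (C : Crv K p a q t e x y z) :
    Nat.card {l : K // l ^ (t * (q ^ 2 - 1)) = 1} = t * (q ^ 2 - 1) ∧ Finite {l : K // l ^ (t * (q ^ 2 - 1)) = 1} := by
  have hq := C.q2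
  have h1 : ((t * (q ^ 2 - 1) : ℕ) : K) ≠ 0 := by
    rw [Nat.cast_mul]
    refine mul_ne_zero C.tK ?_
    have : 1 ≤ q ^ 2 := Nat.one_le_pow _ _ (by omega)
    rw [Nat.cast_sub this, Nat.cast_pow, C.qK]
    simp
  have := card_roots (Polynomial.X ^ (t * (q ^ 2 - 1)) - 1 : Polynomial K)
    (Polynomial.X_pow_sub_one_separable_iff.2 h1) (fun l => l ^ (t * (q ^ 2 - 1)) = 1) (fun c => by simp [sub_eq_zero])
  have h2 : (Polynomial.X ^ (t * (q ^ 2 - 1)) - 1 : Polynomial K).natDegree = t * (q ^ 2 - 1) := by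
    simpa using Polynomial.natDegree_X_pow_sub_C (n := t * (q ^ 2 - 1)) (r := (1 : K))
  rwa [h2] at this

theorem Crv.card_t [IsAlgClosed K] (C : Crv K p a q t e x y z) :
    Nat.card {l : K // l ^ t = 1} = t ∧ Finite {l : K // l ^ t = 1} := by
  have := card_roots (Polynomial.X ^ t - 1 : Polynomial K)
    (Polynomial.X_pow_sub_one_separable_iff.2 C.tK) (fun l => l ^ t = 1) (fun c => by simp [sub_eq_zero])
  have h2 : (Polynomial.X ^ t - 1 : Polynomial K).natDegree = t := by
    simpa using Polynomial.natDegree_X_pow_sub_C (n := t) (r := (1 : K))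
  rwa [h2] at this

theorem Crv.card_b [IsAlgClosed K] (C : Crv K p a q t e x y z) :
    Nat.card {b : K // b ^ (q ^ 2) = b} = q ^ 2 ∧ Finite {b : K // b ^ (q ^ 2) = b} := by
  have hq := C.q2
  have := C.chK
  have h1 : 1 < q ^ 2 := Nat.one_lt_pow (by omega) (by omega)
  have := card_roots (Polynomial.X ^ (q ^ 2) - Polynomial.X : Polynomial K)
    (galois_poly_separable p (q ^ 2) (by
      rw [C.hq, ← pow_mul]; exact dvd_pow_self _ (Nat.mul_ne_zero C.ha.ne' (by omega))))
    (fun b => b ^ (q ^ 2) = b) (fun c => by simp [sub_eq_zero])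
  have h2 : (Polynomial.X ^ (q ^ 2) - Polynomial.X : Polynomial K).natDegree = q ^ 2 :=
    FiniteField.X_pow_card_sub_X_natDegree_eq K h1
  rwa [h2] at this

theorem Crv.card_d [IsAlgClosed K] (C : Crv K p a q t e x y z) (γ : K) :
    Nat.card {d : K // d ^ q + d = γ} = q ∧ Finite {d : K // d ^ q + d = γ} := by
  have hq := C.q2
  have := card_roots (Polynomial.X ^ q + Polynomial.X - Polynomial.C γ : Polynomial K)
    (by
      unfold Polynomial.Separable
      have : Polynomial.derivative (Polynomial.X ^ q + Polynomial.X - Polynomial.C γ : Polynomial K) = 1 := by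
        simp [Polynomial.derivative_X_pow, C.qK]
      rw [this]; exact isCoprime_one_right)
    (fun d => d ^ q + d = γ) (fun c => by simp [sub_eq_zero])
  have h2 : (Polynomial.X ^ q + Polynomial.X - Polynomial.C γ : Polynomial K).natDegree = q := by
    rw [Polynomial.natDegree_sub_C, Polynomial.natDegree_add_eq_left_of_natDegree_lt, Polynomial.natDegree_X_pow]
    rw [Polynomial.natDegree_X_pow, Polynomial.natDegree_X]; omega
  rwa [h2] at this

theorem Crv.card_T [IsAlgClosed K] (C : Crv K p a q t e x y z) : Nat.card (Tp K q) = q ^ 3 ∧ Finite (Tp K q) := by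
  have hb := C.card_b
  have := hb.2
  have hd := fun b : {b : K // b ^ (q ^ 2) = b} => C.card_d (b.1 ^ (q + 1))
  have := fun b => (hd b).2
  have := Fintype.ofFinite {b : K // b ^ (q ^ 2) = b}
  constructor
  · unfold Tp
    rw [Nat.card_sigma]
    simp only [(hd _).1]
    rw [Finset.sum_const, Finset.card_univ, ← Nat.card_eq_fintype_card, hb.1, smul_eq_mul]
    ring
  · unfold Tp; infer_instance

end
end YC1


namespace YC1

section
variable {K F : Type} [Field K] [Field F] [Algebra K F] {p a q t e : ℕ} {x y z : F} {v v' : F → ℤ}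

theorem Crv.card_B [IsAlgClosed K] (C : Crv K p a q t e x y z) (I : Inf K q t x y z v) :
    Nat.card (Bgp K v) = t * (q ^ 2 - 1) * q ^ 3 := by
  have hpar : ∀ P : {l : K // l ^ (t * (q ^ 2 - 1)) = 1} × Tp K q, Par q t P.1.1 P.2.1.1 P.2.2.1 :=
    fun P => ⟨P.1.2, P.2.1.2, P.2.2.2⟩
  choose s hs using fun P : {l : K // l ^ (t * (q ^ 2 - 1)) = 1} × Tp K q => C.exists_shp I (hpar P)
  let φ : {l : K // l ^ (t * (q ^ 2 - 1)) = 1} × Tp K q → Bgp K v :=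
    fun P => ⟨s P, C.shp_B I (C.par_ne (hpar P)) (hs P)⟩
  have hφ : Function.Bijective φ := by
    constructor
    · rintro P Q h
      have h1 : s P = s Q := congrArg Subtype.val h
      have h2 := hs P
      rw [h1] at h2
      obtain ⟨e1, e2, e3⟩ := C.shp_inj I h2 (hs Q)
      obtain ⟨⟨l, hl⟩, ⟨⟨b, hb⟩, ⟨d, hd⟩⟩⟩ := P
      obtain ⟨⟨l', hl'⟩, ⟨⟨b', hb'⟩, ⟨d', hd'⟩⟩⟩ := Q
      simp only at e1 e2 e3
      subst e1 e2 e3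
      rfl
    · rintro ⟨σ, hσ⟩
      obtain ⟨l, β, ε, hp, h⟩ := C.B_shp I (mem_Bgp.1 hσ)
      let P : {l : K // l ^ (t * (q ^ 2 - 1)) = 1} × Tp K q := ⟨⟨l, hp.1⟩, ⟨⟨β, hp.2.1⟩, ⟨ε, hp.2.2⟩⟩⟩
      refine ⟨P, Subtype.ext ?_⟩
      have h' := hs P
      exact C.aut_ext (h'.1.trans h.1.symm) (h'.2.1.trans h.2.1.symm) (h'.2.2.trans h.2.2.symm)
  rw [← Nat.card_congr (Equiv.ofBijective φ hφ), Nat.card_prod, C.card_l.1, C.card_T.1]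

theorem Crv.card_Q [IsAlgClosed K] (C : Crv K p a q t e x y z) (I : Inf K q t x y z v) :
    Nat.card ((F ≃ₐ[K] F) ⧸ Bgp K v) = q ^ 3 + 1 := by
  obtain ⟨w, hw, hwy, hwz⟩ := C.exists_w I
  have hx0 := (C.Ex I).1
  have hww : w * w = 1 := by
    apply C.aut_ext
    · rw [AlgEquiv.mul_apply, hw, map_inv₀, hw, inv_inv]; rfl
    · rw [AlgEquiv.mul_apply, hwy, map_div₀, hw, hwy, AlgEquiv.one_apply]; field_simp
    · have hxe : x ^ e ≠ 0 := pow_ne_zero _ hx0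
      rw [AlgEquiv.mul_apply, hwz, map_div₀, map_neg, map_pow, hw, hwz, AlgEquiv.one_apply, inv_pow]; field_simp
  have hwi : w⁻¹ = w := inv_eq_of_mul_eq_one_left hww
  choose u hu using fun T : Tp K q => C.exists_shp I (C.T_par T)
  let φ : Option (Tp K q) → (F ≃ₐ[K] F) ⧸ Bgp K v := fun o => match o with
    | none => QuotientGroup.mk 1
    | some T => QuotientGroup.mk (u T * w)
  have huB : ∀ T, u T ∈ Bgp K v := fun T => C.shp_B I one_ne_zero (hu T)
  have h1 : ∀ T, φ none ≠ φ (some T) := by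
    intro T h
    have h2 : (1 : F ≃ₐ[K] F)⁻¹ * (u T * w) ∈ Bgp K v := QuotientGroup.eq.1 h
    rw [inv_one, one_mul, Subgroup.mul_mem_cancel_left _ (huB T)] at h2
    exact C.w_not I hw h2
  have hφ : Function.Bijective φ := by
    constructor
    · rintro (_ | T) (_ | T') h
      · rfl
      · exact absurd h (h1 T')
      · exact absurd h.symm (h1 T)
      · have h2 : (u T * w)⁻¹ * (u T' * w) ∈ Bgp K v := QuotientGroup.eq.1 h
        have h3 : (u T * w)⁻¹ * (u T' * w) = w * ((u T)⁻¹ * u T') * w := by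
          rw [mul_inv_rev, hwi]; group
        rw [h3] at h2
        obtain ⟨e1, e2⟩ := C.T_inj I hw hwy (hu T) (hu T') h2
        obtain ⟨⟨b, hb⟩, ⟨d, hd⟩⟩ := T
        obtain ⟨⟨b', hb'⟩, ⟨d', hd'⟩⟩ := T'
        simp only at e1 e2
        subst e1 e2
        rfl
    · intro g
      obtain ⟨σ, rfl⟩ := QuotientGroup.mk_surjective g
      by_cases hσ : Bset K v σ⁻¹
      · refine ⟨none, QuotientGroup.eq.2 ?_⟩
        rw [inv_one, one_mul]
        exact (Subgroup.inv_mem_iff _).1 hσ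
      · obtain ⟨T, hT⟩ := C.decomp I hw hσ
        refine ⟨some T, Eq.symm (QuotientGroup.eq.2 ?_)⟩
        have := hT _ (hu T)
        rwa [mul_assoc] at this
  have hT := C.card_T
  have := hT.2
  rw [← Nat.card_congr (Equiv.ofBijective φ hφ), Finite.card_option, hT.1]

theorem Crv.card_Aut [IsAlgClosed K] (C : Crv K p a q t e x y z) (I : Inf K q t x y z v) :
    Nat.card (F ≃ₐ[K] F) = (q ^ 3 + 1) * q ^ 3 * (q ^ 2 - 1) * t := by
  rw [Subgroup.card_eq_card_quotient_mul_card_subgroup (Bgp K v), C.card_Q I, C.card_B I]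
  ring

/-- the subgroup fixing `x` and `y` -/
def Ngp (K : Type) {F : Type} [Field K] [Field F] [Algebra K F] (x y : F) : Subgroup (F ≃ₐ[K] F) where
  carrier := {σ | σ x = x ∧ σ y = y}
  mul_mem' := by
    rintro σ τ ⟨h1, h2⟩ ⟨h3, h4⟩
    exact ⟨by rw [AlgEquiv.mul_apply, h3, h1], by rw [AlgEquiv.mul_apply, h4, h2]⟩
  one_mem' := ⟨rfl, rfl⟩
  inv_mem' := by
    rintro σ ⟨h1, h2⟩
    constructor
    · nth_rw 1 [← h1]; rw [← AlgEquiv.mul_apply, inv_mul_cancel]; rfl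
    · nth_rw 1 [← h2]; rw [← AlgEquiv.mul_apply, inv_mul_cancel]; rfl

theorem mem_Ngp {σ : F ≃ₐ[K] F} : σ ∈ Ngp K x y ↔ σ x = x ∧ σ y = y := Iff.rfl

theorem Crv.N_shp [IsAlgClosed K] (C : Crv K p a q t e x y z) (I : Inf K q t x y z v) {σ : F ≃ₐ[K] F}
    (hσ : σ ∈ Ngp K x y) : ∃ l : K, l ^ t = 1 ∧ σ z = algebraMap K F l * z := by
  have hB : Bset K v σ := C.B_of I (by rw [hσ.1]; exact C.x_not I)
  obtain ⟨l, β, ε, hp, h⟩ := C.B_shp I hB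
  refine ⟨l, ?_, h.2.2⟩
  have h1 := h.2.1
  rw [hσ.2] at h1
  have h2 := C.y_const I (α := 1) (β := 0) (γ := l ^ t) (δ := β) (by rw [map_one, map_zero, one_mul, add_zero]; exact h1)
  exact h2.1.symm

theorem Crv.card_N [IsAlgClosed K] (C : Crv K p a q t e x y z) (I : Inf K q t x y z v) :
    Nat.card (Ngp K x y) = t := by
  have hq := C.q2
  have hpar : ∀ l : {l : K // l ^ t = 1}, Par q t l.1 0 0 :=
    fun l => ⟨by rw [pow_mul, l.2, one_pow], zero_pow (by positivity), by
      rw [zero_pow (by omega), zero_pow (by omega), add_zero]⟩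
  choose s hs using fun l : {l : K // l ^ t = 1} => C.exists_shp I (hpar l)
  let φ : {l : K // l ^ t = 1} → Ngp K x y := fun l => ⟨s l, by
    have h := hs l
    rw [Shp, l.2] at h
    refine ⟨?_, ?_⟩
    · rw [h.1, zero_pow (by omega)]; simp
    · rw [h.2.1]; simp⟩
  have hφ : Function.Bijective φ := by
    constructor
    · intro l l' h
      have h1 : s l = s l' := congrArg Subtype.val h
      have h2 := hs l
      rw [h1] at h2
      exact Subtype.ext (C.shp_inj I h2 (hs l')).1
    · rintro ⟨σ, hσ⟩
      obtain ⟨l, hl, hz⟩ := C.N_shp I hσ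
      refine ⟨⟨l, hl⟩, Subtype.ext ?_⟩
      have h' := (φ ⟨l, hl⟩).2
      exact C.aut_ext (h'.1.trans hσ.1.symm) (h'.2.trans hσ.2.symm) ((hs ⟨l, hl⟩).2.2.trans hz.symm)
  rw [← Nat.card_congr (Equiv.ofBijective φ hφ), C.card_t.1]

theorem Crv.cyc_N [IsAlgClosed K] (C : Crv K p a q t e x y z) (I : Inf K q t x y z v) :
    IsCyclic (Ngp K x y) := by
  have hz0 := (C.Ez I).1
  have hfin : Finite (Ngp K x y) := Nat.finite_of_card_ne_zero (by
    rw [C.card_N I]; have := C.ht; omega)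
  let f : Ngp K x y →* F :=
    { toFun := fun n => n.1 z / z
      map_one' := by simp [hz0]
      map_mul' := by
        rintro ⟨σ, hσ⟩ ⟨τ, hτ⟩
        obtain ⟨l, hl, h1⟩ := C.N_shp I hτ
        obtain ⟨l', hl', h2⟩ := C.N_shp I hσ
        simp only [Subgroup.coe_mul, AlgEquiv.mul_apply, h1, h2, map_mul, AlgEquiv.commutes]
        field_simp }
  refine isCyclic_of_subgroup_isDomain f ?_
  rintro ⟨σ, hσ⟩ ⟨τ, hτ⟩ h
  have h1 : σ z / z = τ z / z := h
  rw [div_left_inj' hz0] at h1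
  exact Subtype.ext (C.aut_ext (hσ.1.trans hτ.1.symm) (hσ.2.trans hτ.2.symm) h1)

theorem Crv.B_fix [IsAlgClosed K] (C : Crv K p a q t e x y z) (I : Inf K q t x y z v) {σ n : F ≃ₐ[K] F}
    (hσ : Bset K v σ) (hn : n ∈ Ngp K x y) : n (σ x) = σ x ∧ n (σ y) = σ y := by
  obtain ⟨l, β, ε, hp, h⟩ := C.B_shp I hσ
  rw [h.1, h.2.1]
  simp only [map_add, map_mul, AlgEquiv.commutes, hn.1, hn.2, and_self]

theorem Crv.all_fix [IsAlgClosed K] (C : Crv K p a q t e x y z) (I : Inf K q t x y z v) (σ : F ≃ₐ[K] F) {n : F ≃ₐ[K] F}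
    (hn : n ∈ Ngp K x y) : n (σ x) = σ x ∧ n (σ y) = σ y := by
  by_cases hσ : Bset K v σ
  · exact C.B_fix I hσ hn
  obtain ⟨w, hw, hwy, hwz⟩ := C.exists_w I
  obtain ⟨T, hT⟩ := C.decomp I hw hσ
  obtain ⟨u, hu⟩ := C.exists_shp I (C.T_par T)
  have hb := hT u hu
  have huB : u⁻¹ ∈ Bgp K v := inv_mem (C.shp_B I one_ne_zero hu)
  obtain ⟨l, β, ε, hp, h⟩ := C.B_shp I (mem_Bgp.1 huB)
  set b := σ * u * w with hbdef
  have hwi : w⁻¹ = w := by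
    have hx0 := (C.Ex I).1
    apply inv_eq_of_mul_eq_one_left
    apply C.aut_ext
    · rw [AlgEquiv.mul_apply, hw, map_inv₀, hw, inv_inv]; rfl
    · rw [AlgEquiv.mul_apply, hwy, map_div₀, hw, hwy, AlgEquiv.one_apply]; field_simp
    · have hxe : x ^ e ≠ 0 := pow_ne_zero _ hx0
      rw [AlgEquiv.mul_apply, hwz, map_div₀, map_neg, map_pow, hw, hwz, AlgEquiv.one_apply, inv_pow]; field_simp
  have hσe : σ = b * w * u⁻¹ := by
    have : σ = b * w⁻¹ * u⁻¹ := by rw [hbdef]; group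
    rwa [hwi] at this
  obtain ⟨f1, f2⟩ := C.B_fix I hb hn
  rw [hσe]
  simp only [AlgEquiv.mul_apply]
  rw [h.1, h.2.1]
  simp only [map_add, map_mul, AlgEquiv.commutes, hw, hwy, map_inv₀, map_div₀, f1, f2, and_self]

theorem Crv.main [IsAlgClosed K] (C : Crv K p a q t e x y z) :
    Finite (F ≃ₐ[K] F) ∧ Nat.card (F ≃ₐ[K] F) = (q ^ 3 + 1) * q ^ 3 * (q ^ 2 - 1) * t ∧
    ∃ N : Subgroup (F ≃ₐ[K] F), (N : Set (F ≃ₐ[K] F)) = {σ | σ x = x ∧ σ y = y} ∧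
      IsCyclic N ∧ Nat.card N = t ∧ N.Normal ∧
        Nat.card ((F ≃ₐ[K] F) ⧸ N) = (q ^ 3 + 1) * q ^ 3 * (q ^ 2 - 1) := by
  obtain ⟨v, I⟩ := C.exists_inf
  have hq := C.q2
  have ht := C.ht
  have hq2 : 2 ^ 2 ≤ q ^ 2 := Nat.pow_le_pow_left hq 2
  have hc := C.card_Aut I
  refine ⟨Nat.finite_of_card_ne_zero ?_, hc, Ngp K x y, rfl, C.cyc_N I, C.card_N I, ?_, ?_⟩
  · rw [hc]
    have : 0 < q ^ 2 - 1 := by omega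
    positivity
  · constructor
    intro n hn g
    have h := C.all_fix I g⁻¹ hn
    refine ⟨?_, ?_⟩
    · rw [AlgEquiv.mul_apply, AlgEquiv.mul_apply, h.1, ← AlgEquiv.mul_apply, mul_inv_cancel]; rfl
    · rw [AlgEquiv.mul_apply, AlgEquiv.mul_apply, h.2, ← AlgEquiv.mul_apply, mul_inv_cancel]; rfl
  · rw [Subgroup.card_eq_card_quotient_mul_card_subgroup (Ngp K x y), C.card_N I] at hc
    exact Nat.eq_of_mul_eq_mul_right (by omega) hc

end
end YC1

namespace YC1

/-- the function field of the curve as an instance of the abstract setting -/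
theorem crv_Y (p a q t e : ℕ) (hp : p.Prime) (ha : 0 < a) (hq : q = p ^ a) (ht : 1 < t)
    (hte : t * e + q = q ^ 2 + 1) (K : Type) [Field K] [CharP K p] [hI : (YIdeal K q t).IsPrime] :
    Crv K p a q t e (Yx K q t) (Yy K q t)
      (algebraMap (YRing K q t) (YField K q t) (Ideal.Quotient.mk _ (X 2))) := by
  set z := algebraMap (YRing K q t) (YField K q t) (Ideal.Quotient.mk _ (X 2)) with hz
  let ψ : MvPolynomial (Fin 3) K →ₐ[K] YField K q t :=
    (IsScalarTower.toAlgHom K (YRing K q t) (YField K q t)).comp (Ideal.Quotient.mkₐ K (YIdeal K q t))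
  have hψ : ∀ f, ψ f = algebraMap (YRing K q t) (YField K q t) (Ideal.Quotient.mk _ f) := fun f => rfl
  have hψ0 : ψ (X 0) = Yx K q t := rfl
  have hψ1 : ψ (X 1) = Yy K q t := rfl
  have hψ2 : ψ (X 2) = z := rfl
  have hψI : ∀ f, ψ f = 0 ↔ f ∈ YIdeal K q t := by
    intro f
    rw [hψ, map_eq_zero_iff _ (IsFractionRing.injective (YRing K q t) (YField K q t)),
      Ideal.Quotient.eq_zero_iff_mem]
  have hset : ψ '' Set.range (X : Fin 3 → MvPolynomial (Fin 3) K) = {Yx K q t, Yy K q t, z} := by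
    rw [← Set.range_comp]
    ext f
    simp only [Set.mem_range, Function.comp_apply, Set.mem_insert_iff, Set.mem_singleton_iff]
    constructor
    · rintro ⟨i, rfl⟩
      fin_cases i
      · left; exact hψ0
      · right; left; exact hψ1
      · right; right; exact hψ2
    · rintro (h | h | h)
      · exact ⟨0, by rw [h]; exact hψ0⟩
      · exact ⟨1, by rw [h]; exact hψ1⟩
      · exact ⟨2, by rw [h]; exact hψ2⟩
  have hrange : ψ.range = Algebra.adjoin K {Yx K q t, Yy K q t, z} := by
    rw [← hset, ← AlgHom.map_adjoin, MvPolynomial.adjoin_range_X, Algebra.map_top]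
  refine ⟨hp, ha, hq, inferInstance, ht, hte, ?_, ?_, ?_, ?_⟩
  · have h : ψ (X 2 ^ t - (X 1 ^ (q ^ 2) - X 1)) = 0 :=
      (hψI _).2 (Ideal.subset_span (by simp))
    rw [map_sub, map_sub, map_pow, map_pow, hψ1, hψ2] at h
    exact sub_eq_zero.1 h
  · have h : ψ (X 1 ^ (q + 1) - (X 0 ^ q + X 0)) = 0 :=
      (hψI _).2 (Ideal.subset_span (by simp))
    rw [map_sub, map_add, map_pow, map_pow, hψ1, hψ0] at h
    exact sub_eq_zero.1 h
  · intro f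
    obtain ⟨r, s, hs, rfl⟩ := IsFractionRing.div_surjective (A := YRing K q t) f
    obtain ⟨r', rfl⟩ := Ideal.Quotient.mk_surjective r
    obtain ⟨s', rfl⟩ := Ideal.Quotient.mk_surjective s
    rw [← hrange]
    refine ⟨_, ⟨r', rfl⟩, _, ⟨s', rfl⟩, ?_, rfl⟩
    exact (map_ne_zero_iff _ (IsFractionRing.injective (YRing K q t) (YField K q t))).2
      (nonZeroDivisors.ne_zero hs)
  · intro x' y' z' h1 h2
    let θ : MvPolynomial (Fin 3) K →ₐ[K] YField K q t := MvPolynomial.aeval ![x', y', z']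
    have hθ : ∀ f, ψ f = 0 → θ f = 0 := by
      intro f hf
      rw [hψI] at hf
      have : YIdeal K q t ≤ RingHom.ker θ := by
        refine Ideal.span_le.2 ?_
        rintro g (rfl | rfl)
        · show θ _ = 0
          simp [θ, h1]
        · show θ _ = 0
          simp [θ, h2]
      exact this hf
    have hsurj : Function.Surjective ψ.rangeRestrict := ψ.rangeRestrict_surjective
    have hker : ∀ f, f ∈ RingHom.ker ψ.rangeRestrict → θ f = 0 := by
      intro f hf
      apply hθ
      exact congrArg Subtype.val (show ψ.rangeRestrict f = 0 from hf)
    let Θ : ψ.range →ₐ[K] YField K q t :=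
      (Ideal.Quotient.liftₐ (RingHom.ker ψ.rangeRestrict) θ hker).comp
        (Ideal.quotientKerAlgEquivOfSurjective hsurj).symm.toAlgHom
    have hΘ : ∀ (i : Fin 3) (hm : ψ (X i) ∈ ψ.range), Θ ⟨ψ (X i), hm⟩ = ![x', y', z'] i := by
      intro i hm
      have h3 : (⟨ψ (X i), hm⟩ : ψ.range) = Ideal.quotientKerAlgEquivOfSurjective hsurj (Ideal.Quotient.mk _ (X i)) := rfl
      have h4 : (Ideal.quotientKerAlgEquivOfSurjective hsurj).symm ⟨ψ (X i), hm⟩ = Ideal.Quotient.mk _ (X i) := by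
        rw [h3, AlgEquiv.symm_apply_apply]
      show Ideal.Quotient.liftₐ _ θ hker ((Ideal.quotientKerAlgEquivOfSurjective hsurj).symm ⟨ψ (X i), hm⟩) = _
      rw [h4]
      show θ (X i) = _
      simp [θ]
    exact ⟨Θ.comp (Subalgebra.equivOfEq _ _ hrange.symm).toAlgHom,
      hΘ 0 ⟨X 0, rfl⟩, hΘ 1 ⟨X 1, rfl⟩, hΘ 2 ⟨X 2, rfl⟩⟩

end YC1

/-- Theorem (main theorem for `Y_{n,s}`, special case): if `3 ∣ n` and `(m/s) ∣ q^2-q+1`,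
then `Aut(F/K)` is finite of order `(q^3+1) q^3 (q^2-1) (m/s)`; moreover the subgroup
`N = {σ : σ x = x, σ y = y}` (the stabilizer of both `x` and `y`) is cyclic of order
`m/s`, normal, and the quotient `Aut(F/K)/N` has order `(q^3+1) q^3 (q^2-1)`
(it is isomorphic to `PGU(3,q)`). -/
theorem stmt1 (p a q n m s : ℕ) (hp : p.Prime) (ha : 0 < a) (hq : q = p ^ a)
    (hn : 3 ≤ n) (hodd : Odd n) (hm : m * (q + 1) = q ^ n + 1)
    (hs : s ∣ m) (hs0 : 0 < s) (hsm : s ≠ m)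
    (K : Type) [Field K] [IsAlgClosed K] [CharP K p]
    [hI : (YIdeal K q (m / s)).IsPrime]
    (h3n : 3 ∣ n) (hdvd : m / s ∣ q ^ 2 - q + 1) :
    Finite (YField K q (m / s) ≃ₐ[K] YField K q (m / s)) ∧
    Nat.card (YField K q (m / s) ≃ₐ[K] YField K q (m / s))
      = (q ^ 3 + 1) * q ^ 3 * (q ^ 2 - 1) * (m / s) ∧
    ∃ N : Subgroup (YField K q (m / s) ≃ₐ[K] YField K q (m / s)),
      (N : Set (YField K q (m / s) ≃ₐ[K] YField K q (m / s)))
          = {σ | σ (Yx K q (m / s)) = Yx K q (m / s) ∧ σ (Yy K q (m / s)) = Yy K q (m / s)} ∧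
      IsCyclic N ∧ Nat.card N = m / s ∧ N.Normal ∧
        Nat.card ((YField K q (m / s) ≃ₐ[K] YField K q (m / s)) ⧸ N)
          = (q ^ 3 + 1) * q ^ 3 * (q ^ 2 - 1) := by
  obtain ⟨e, he⟩ := hdvd
  have hq2 : 2 ≤ q := by rw [hq]; exact hp.two_le.trans (Nat.le_self_pow ha.ne' p)
  have hm0 : 0 < m := by
    rcases Nat.eq_zero_or_pos m with h | h
    · rw [h] at hm; omega
    · exact h
  have ht : 1 < m / s := by
    obtain ⟨k, rfl⟩ := hs
    rw [Nat.mul_div_cancel_left _ hs0]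
    rcases k with _ | _ | k
    · omega
    · omega
    · omega
  have hte : (m / s) * e + q = q ^ 2 + 1 := by
    have : q ≤ q ^ 2 := Nat.le_self_pow (by omega) q
    omega
  exact (YC1.crv_Y p a q (m / s) e hp ha hq ht hte K).main
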